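/- arXiv:1006.3156 — 10 statements merged into one kernel-verified Lean document; each statement's English description precedes it below -/
import Mathlib

section
/- Let C be an observable (n,k,δ) convolutional code over a finite field F given by a parity-check matrix H(z), and let d = d_{j₀}^c(C) be its j₀-th column distance. Let E ⊆ ℕ×{1,…,n} be a set of erased coefficient positions such that for every t ≥ 0 the sliding window {t, t+1, …, t+j₀}×{1,…,n} (of length (j₀+1)n) contains at most d−1 elements of E. Then any two codewords of C that agree at every coefficient position outside E are equal; hence the transmitted sequence can be completely recovered. -/
open Polynomial Matrix

/-- Weight of the `j`-th truncation `v₀ + v₁ z + ⋯ + v_j z^j` of a vector of polynomials: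
the number of nonzero coefficient positions `(i, c)` with `i ≤ j`. -/
noncomputable def truncWeight {F : Type*} [Semiring F] {n : ℕ} (j : ℕ)
    (v : Fin n → Polynomial F) : ℕ :=
  ∑ c : Fin n, ((v c).support.filter (fun i => i ≤ j)).card

/-- `d` is the `j`-th column distance of the code `C`. -/
def IsColDist {F : Type*} [Semiring F] {n : ℕ} (C : Set (Fin n → Polynomial F))
    (j d : ℕ) : Prop :=
  IsLeast {w | ∃ v ∈ C, (fun c => (v c).coeff 0) ≠ 0 ∧ truncWeight j v = w} d

theorem truncWeight_eq_ncard {F : Type*} [Semiring F] {n : ℕ} (j : ℕ)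
    (v : Fin n → Polynomial F) :
    truncWeight j v = {p : ℕ × Fin n | p.1 ≤ j ∧ (v p.2).coeff p.1 ≠ 0}.ncard := by
  have h : {p : ℕ × Fin n | p.1 ≤ j ∧ (v p.2).coeff p.1 ≠ 0} =
      (fun q : (_ : Fin n) × ℕ => (q.2, q.1)) ''
        (Finset.univ.sigma fun c => (v c).support.filter (fun i => i ≤ j) :
          Finset ((_ : Fin n) × ℕ)) := by
    ext ⟨i, c⟩
    constructor
    · rintro ⟨hi, hc⟩
      exact ⟨⟨c, i⟩, by simpa using ⟨hc, hi⟩, rfl⟩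
    · rintro ⟨⟨c', i'⟩, hq, heq⟩
      obtain ⟨rfl, rfl⟩ := Prod.mk.inj heq
      simpa [and_comm] using hq
  rw [h, Set.ncard_image_of_injective, Set.ncard_coe_finset, Finset.card_sigma, truncWeight]
  rintro ⟨c, i⟩ ⟨c', i'⟩ heq
  obtain ⟨rfl, rfl⟩ := Prod.mk.inj heq
  rfl

theorem finite_window {n : ℕ} (E : Set (ℕ × Fin n)) (a b : ℕ) :
    {p : ℕ × Fin n | p ∈ E ∧ a ≤ p.1 ∧ p.1 ≤ b}.Finite :=
  ((Set.finite_Icc a b).prod Set.finite_univ).subset fun _ hp => ⟨hp.2, Set.mem_univ _⟩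

theorem truncWeight_pos {F : Type*} [Semiring F] {n : ℕ} (j : ℕ) {v : Fin n → Polynomial F}
    (hv : (fun c => (v c).coeff 0) ≠ 0) : 0 < truncWeight j v := by
  obtain ⟨c, hc⟩ := Function.ne_iff.mp hv
  have hfin : {p : ℕ × Fin n | p.1 ≤ j ∧ (v p.2).coeff p.1 ≠ 0}.Finite :=
    (finite_window Set.univ 0 j).subset fun p hp => ⟨trivial, Nat.zero_le _, hp.1⟩
  rw [truncWeight_eq_ncard, Set.ncard_pos hfin]
  exact ⟨(0, c), Nat.zero_le j, hc⟩

/-- A nonzero vector of polynomials is `X ^ t` times one with nonzero constant term. -/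
theorem exists_eq_X_pow_smul {F : Type*} [CommSemiring F] {n : ℕ} {u : Fin n → Polynomial F}
    (hu : u ≠ 0) : ∃ (t : ℕ) (q : Fin n → Polynomial F),
      u = (X ^ t : Polynomial F) • q ∧ (fun c => (q c).coeff 0) ≠ 0 := by
  classical
  have hex : ∃ t c, (u c).coeff t ≠ 0 := by
    by_contra! h
    exact hu (funext fun c => Polynomial.ext fun t => h t c)
  have hdvd (c : Fin n) : (X ^ Nat.find hex : Polynomial F) ∣ u c := by
    refine X_pow_dvd_iff.mpr fun i hi => ?_
    have := Nat.find_min hex hi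
    push Not at this
    exact this c
  choose q hq using hdvd
  refine ⟨Nat.find hex, q, funext hq, fun h => ?_⟩
  obtain ⟨c, hc⟩ := Nat.find_spec hex
  apply hc
  rw [hq c, coeff_X_pow_mul', if_pos le_rfl, Nat.sub_self]
  exact congrFun h c

/-- if `d` is the `j₀`-th column distance of an observable convolutional code
given by a parity-check matrix `H(z)`, and each sliding window of length `(j₀+1)n` contains
at most `d - 1` erased coefficient positions, then any two codewords agreeing outside the
erasures coincide. -/
theorem stmt_1 {F : Type*} [Field F] [Fintype F] {n k : ℕ} (hk : 0 < k) (hkn : k < n)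
    (H : Matrix (Fin (n - k)) (Fin n) (Polynomial F))
    (hfull : ∃ e : Fin (n - k) ↪ Fin n, (H.submatrix id (⇑e)).det ≠ 0)
    (C : Set (Fin n → Polynomial F))
    (hC : C = {v | H.mulVec v = 0})
    (j₀ d : ℕ)
    (hd : IsColDist C j₀ d)
    (E : Set (ℕ × Fin n))
    (hE : ∀ t : ℕ, {p : ℕ × Fin n | p ∈ E ∧ t ≤ p.1 ∧ p.1 ≤ t + j₀}.ncard ≤ d - 1) :
    ∀ v ∈ C, ∀ w ∈ C,
      (∀ (i : ℕ) (c : Fin n), (i, c) ∉ E → (v c).coeff i = (w c).coeff i) → v = w := by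
  subst hC
  intro v hv w hw hvw
  by_contra hne
  obtain ⟨t, q, hq, hq0⟩ := exists_eq_X_pow_smul (sub_ne_zero.mpr hne)
  have hqC : H.mulVec q = 0 := by
    have h : (X ^ t : Polynomial F) • H.mulVec q = 0 := by
      rw [← mulVec_smul, ← hq, mulVec_sub,
        show H.mulVec v = 0 from hv, show H.mulVec w = 0 from hw, sub_zero]
    exact (smul_eq_zero.mp h).resolve_left (pow_ne_zero t X_ne_zero)
  have hcoeff (i : ℕ) (c : Fin n) :
      (q c).coeff i = (v c).coeff (i + t) - (w c).coeff (i + t) := by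
    rw [← coeff_sub, ← Pi.sub_apply, hq, Pi.smul_apply, smul_eq_mul, coeff_X_pow_mul]
  have hle : d ≤ truncWeight j₀ q := hd.2 ⟨q, hqC, hq0, rfl⟩
  have hpos : 0 < d := by
    obtain ⟨x, -, hx0, rfl⟩ := hd.1
    exact truncWeight_pos j₀ hx0
  have hwindow : truncWeight j₀ q ≤ d - 1 := by
    rw [truncWeight_eq_ncard]
    refine le_trans (Set.ncard_le_ncard_of_injOn (fun p => (p.1 + t, p.2)) ?_ ?_
      (finite_window E t (t + j₀))) (hE t)
    · rintro ⟨i, c⟩ ⟨hi, hc⟩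
      refine ⟨?_, Nat.le_add_left t i, ?_⟩
      · by_contra hmem
        exact hc ((hcoeff i c).trans (sub_eq_zero.mpr (hvw _ _ hmem)))
      · dsimp only at hi ⊢
        omega
    · rintro ⟨i, c⟩ - ⟨i', c'⟩ - heq
      simpa using heq
  omega
end

section
/- For all positive integers k, n, δ with k < n, there exists a finite field F and an (n,k,δ) convolutional code C over F that is reverse-MDP, i.e., both C and its reverse code C̄ are maximum distance profile codes. -/
open Polynomial Matrix

/-- `δ` is the degree of the convolutional code with generator matrix `G`. -/
def IsCodeDegree {F : Type*} [Field F] {n k : ℕ} (G : Matrix (Fin n) (Fin k) (Polynomial F))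
    (δ : ℕ) : Prop :=
  IsGreatest {d | ∃ e : Fin k ↪ Fin n,
    (G.submatrix (⇑e) id).det ≠ 0 ∧ ((G.submatrix (⇑e) id).det).natDegree = d} δ

/-- The reverse code: `v_s + v_{s-1} z + ⋯ + v_0 z^s` for `v_0 + ⋯ + v_s z^s ∈ C`. -/
def revCode {F : Type*} [Semiring F] {n : ℕ} (C : Set (Fin n → Polynomial F)) :
    Set (Fin n → Polynomial F) :=
  {w | ∃ v ∈ C, ∃ s : ℕ, (∀ c, (v c).natDegree ≤ s) ∧ w = fun c => (v c).reflect s}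

/-- There is an `(n,k,δ)` reverse-MDP convolutional code over `F`: a full-rank generator
matrix `G` of degree `δ` such that both the code and its reverse code have `L`-th column
distance `(n-k)(L+1)+1`, where `L = ⌊δ/k⌋ + ⌊δ/(n-k)⌋`. -/
def ExistsReverseMDPCode (F : Type) [Field F] [Fintype F] (n k δ : ℕ) : Prop :=
  ∃ G : Matrix (Fin n) (Fin k) (Polynomial F),
    (∃ e : Fin k ↪ Fin n, (G.submatrix (⇑e) id).det ≠ 0) ∧
    IsCodeDegree G δ ∧
    IsColDist {v | ∃ u : Fin k → Polynomial F, v = G.mulVec u}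
      (δ / k + δ / (n - k)) ((n - k) * (δ / k + δ / (n - k) + 1) + 1) ∧
    IsColDist (revCode {v | ∃ u : Fin k → Polynomial F, v = G.mulVec u})
      (δ / k + δ / (n - k)) ((n - k) * (δ / k + δ / (n - k) + 1) + 1)

/-- The entry in row `x` and column `y` of the lower triangular Toeplitz matrix of `t`. -/
def toeplitzEntry {K : Type*} [Zero K] (t : ℕ → K) (x y : ℕ) : K :=
  if y ≤ x then t (x - y) else 0

/-- Every minor of the lower triangular Toeplitz matrix of `t` that is not forced to vanish by
the triangular shape is nonzero. -/
def IsSuperregular {K : Type*} [CommRing K] (t : ℕ → K) : Prop :=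
  ∀ (m : ℕ) (r c : Fin m → ℕ), StrictMono r → StrictMono c → (∀ i, c i ≤ r i) →
    (Matrix.of fun i j => toeplitzEntry t (r i) (c j)).det ≠ 0

theorem Subalgebra.det_mem {R K ι : Type*} [CommRing R] [CommRing K] [Algebra R K] [Fintype ι]
    [DecidableEq ι] (S : Subalgebra R K) {M : Matrix ι ι K} (h : ∀ i j, M i j ∈ S) :
    M.det ∈ S := by
  rw [Matrix.det_apply']
  exact S.sum_mem fun σ _ => S.mul_mem (by simp) (S.prod_mem fun i _ => h _ _)

theorem AlgebraicIndependent.isSuperregular {K : Type*} [Field K] [Algebra ℚ K] {t : ℕ → K}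
    (ht : AlgebraicIndependent ℚ t) : IsSuperregular t := by
  intro m
  induction m using Nat.strong_induction_on with
  | _ m ih =>
  have ih' : ∀ (ι : Type) [Fintype ι] [LinearOrder ι] (r c : ι → ℕ), Fintype.card ι < m →
      StrictMono r → StrictMono c → (∀ i, c i ≤ r i) →
      (Matrix.of fun i j => toeplitzEntry t (r i) (c j)).det ≠ 0 := by
    intro ι _ _ r c hm hr hc hcr
    let e := Fintype.orderIsoFinOfCardEq ι rfl
    have := ih _ hm (r ∘ e) (c ∘ e) (hr.comp e.strictMono) (hc.comp e.strictMono)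
      fun i => hcr _
    rwa [← Matrix.det_submatrix_equiv_self e.toEquiv]
  intro r c hr hc hcr
  obtain _ | m := m
  · simp
  set M : Matrix (Fin (m + 1)) (Fin (m + 1)) K :=
    Matrix.of fun i j => toeplitzEntry t (r i) (c j) with hM
  by_cases hblock : ∃ i : Fin m, r i.castSucc < c i.succ
  · obtain ⟨i₀, hi₀⟩ := hblock
    rw [Matrix.twoBlockTriangular_det M (fun i => i₀.castSucc < i)]
    · refine mul_ne_zero ?_ ?_
      · refine ih' {i // i₀.castSucc < i} (fun i => r i) (fun i => c i) ?_
          (fun _ _ h => hr h) (fun _ _ h => hc h) (fun i => hcr i)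
        simpa using Fintype.card_subtype_lt (p := fun i => i₀.castSucc < i) (x := i₀.castSucc)
          (lt_irrefl _)
      · refine ih' {i // ¬ i₀.castSucc < i} (fun i => r i) (fun i => c i) ?_
          (fun _ _ h => hr h) (fun _ _ h => hc h) (fun i => hcr i)
        have := Fintype.card_subtype_lt (p := fun i => ¬ i₀.castSucc < i) (x := i₀.succ)
          (by simp)
        rwa [Fintype.card_fin] at this
    · intro i hi j hj
      have h1 : r i ≤ r i₀.castSucc := hr.monotone (not_lt.mp hi)
      have h2 : c i₀.succ ≤ c j := hc.monotone (by
        rw [Fin.lt_def] at hj; rw [Fin.le_def]; simpa using hj)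
      simp only [hM, Matrix.of_apply, toeplitzEntry]
      rw [if_neg (by omega)]
  · push Not at hblock
    set D := r (Fin.last m) - c 0 with hD
    set A := Algebra.adjoin ℚ (t '' Set.Iio D) with hA
    have hentry : ∀ i j, i ≠ Fin.last m ∨ j ≠ 0 → M i j ∈ A := by
      intro i j hij
      simp only [hM, Matrix.of_apply, toeplitzEntry]
      split_ifs with h
      · refine Algebra.subset_adjoin ⟨_, ?_, rfl⟩
        have h1 : r i ≤ r (Fin.last m) := hr.monotone (Fin.le_last i)
        have h2 : c 0 ≤ c j := hc.monotone (Fin.zero_le j)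
        have h3 : r i < r (Fin.last m) ∨ c 0 < c j := hij.imp
          (fun h => hr (Fin.lt_last_iff_ne_last.mpr h)) (fun h => hc (Fin.pos_iff_ne_zero.mpr h))
        simp only [Set.mem_Iio, hD]
        omega
      · exact A.zero_mem
    have hsub : ∀ j : Fin (m + 1),
        (M.submatrix (Fin.last m).succAbove j.succAbove).det ∈ A := fun j =>
      A.det_mem fun i l => hentry _ _ (Or.inl (Fin.succAbove_ne _ _))
    have hcorner : M (Fin.last m) 0 = t D := by
      have := (hc.monotone (Fin.zero_le (Fin.last m))).trans (hcr (Fin.last m))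
      simp [hM, toeplitzEntry, this, hD]
    have hminor : (M.submatrix (Fin.last m).succAbove (0 : Fin (m + 1)).succAbove).det ≠ 0 := by
      have := ih m (Nat.lt_succ_self m) (fun i => r i.castSucc) (fun i => c i.succ)
        (fun _ _ h => hr (by simpa using h)) (fun _ _ h => hc (by simpa using h)) hblock
      convert this using 2
      ext i j
      simp [hM]
    have htr := ht.transcendental_adjoin (s := Set.Iio D) (i := D) (by simp)
    intro hdet
    rw [Matrix.det_succ_row M (Fin.last m), Fin.sum_univ_succ, hcorner] at hdet
    have ha : (-1 : K) ^ ((Fin.last m : ℕ) + ((0 : Fin (m + 1)) : ℕ)) *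
        (M.submatrix (Fin.last m).succAbove (0 : Fin (m + 1)).succAbove).det ∈ A :=
      A.mul_mem (A.pow_mem (A.neg_mem A.one_mem) _) (hsub 0)
    have hb : ∑ j : Fin m, (-1 : K) ^ ((Fin.last m : ℕ) + (j.succ : ℕ)) * M (Fin.last m) j.succ *
        (M.submatrix (Fin.last m).succAbove j.succ.succAbove).det ∈ A :=
      A.sum_mem fun j _ => A.mul_mem (A.mul_mem (A.pow_mem (A.neg_mem A.one_mem) _)
        (hentry _ _ (Or.inr (Fin.succ_ne_zero j)))) (hsub _)
    refine htr ⟨C ⟨_, ha⟩ * X + C ⟨_, hb⟩, ?_, ?_⟩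
    · intro h0
      have := congrArg (fun p => p.coeff 1) h0
      simp only [coeff_add, coeff_C_mul, coeff_X_one, mul_one, coeff_C_succ, add_zero,
        coeff_zero] at this
      have := congrArg Subtype.val this
      exact (mul_eq_zero.mp this).elim (by simp) hminor
    · simp only [map_add, map_mul, aeval_C, aeval_X]
      rw [← hdet]
      simp only [Subalgebra.algebraMap_def, Algebra.algebraMap_self, RingHom.id_apply]
      ring

theorem exists_isSuperregular : ∃ (K : Type) (_ : Field K) (t : ℕ → K), IsSuperregular t :=
  ⟨FractionRing (MvPolynomial ℕ ℚ), inferInstance,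
    fun i => algebraMap (MvPolynomial ℕ ℚ) _ (MvPolynomial.X i),
    ((MvPolynomial.algebraicIndependent_X ℕ ℚ).map' (f := IsScalarTower.toAlgHom ℚ
      (MvPolynomial ℕ ℚ) (FractionRing (MvPolynomial ℕ ℚ)))
      (IsFractionRing.injective _ _)).isSuperregular⟩

namespace IsSuperregular

variable {K ι κ : Type*} [Field K] {t : ℕ → K}

theorem eq_zero_of_sum_eq_zero (ht : IsSuperregular t) {R : Finset ι} {C : Finset κ}
    {ρ : ι → ℕ} {γ : κ → ℕ} (hρ : Set.InjOn ρ R) (hγ : Set.InjOn γ C) (hcard : R.card = C.card)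
    (hcount : ∀ x ∈ R, (R.filter fun x' => ρ x' ≤ ρ x).card ≤ (C.filter fun y => γ y ≤ ρ x).card)
    {a : κ → K} (ha : ∀ x ∈ R, ∑ y ∈ C, toeplitzEntry t (ρ x) (γ y) * a y = 0) :
    ∀ y ∈ C, a y = 0 := by
  classical
  set r := (R.image ρ).orderEmbOfFin (Finset.card_image_of_injOn hρ) with hr
  set c := (C.image γ).orderEmbOfFin ((Finset.card_image_of_injOn hγ).trans hcard.symm) with hc
  have hrmem : ∀ i, ∃ x ∈ R, ρ x = r i := fun i =>
    Finset.mem_image.mp (Finset.orderEmbOfFin_mem _ _ i)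
  have hcmem : ∀ i, ∃ y ∈ C, γ y = c i := fun i =>
    Finset.mem_image.mp (Finset.orderEmbOfFin_mem _ _ i)
  choose p hpR hp using hrmem
  choose q hqC hq using hcmem
  have hpinj : Function.Injective p := fun i j h => r.injective (by rw [← hp, ← hp, h])
  have hqinj : Function.Injective q := fun i j h => c.injective (by rw [← hq, ← hq, h])
  have hqsurj : ∀ y ∈ C, ∃ j, q j = y := by
    intro y hy
    have : γ y ∈ Set.range c := by
      rw [hc, Finset.range_orderEmbOfFin]
      exact Finset.mem_coe.mpr (Finset.mem_image_of_mem _ hy)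
    obtain ⟨j, hj⟩ := this
    exact ⟨j, hγ (hqC j) hy (by rw [hq, hj])⟩
  have hcr : ∀ i, c i ≤ r i := by
    intro i
    by_contra! hlt
    have h1 : (i : ℕ) + 1 ≤ (R.filter fun x' => ρ x' ≤ ρ (p i)).card := by
      rw [← Fin.card_Iic i, ← Finset.card_image_of_injective (Finset.Iic i) hpinj]
      refine Finset.card_le_card fun x hx => ?_
      obtain ⟨j, hj, rfl⟩ := Finset.mem_image.mp hx
      rw [Finset.mem_filter, hp, hp]
      exact ⟨hpR j, r.monotone (Finset.mem_Iic.mp hj)⟩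
    have h2 : (C.filter fun y => γ y ≤ ρ (p i)).card ≤ i := by
      rw [← Fin.card_Iio i, ← Finset.card_image_of_injective (Finset.Iio i) hqinj]
      refine Finset.card_le_card fun y hy => ?_
      obtain ⟨hyC, hle⟩ := Finset.mem_filter.mp hy
      obtain ⟨j, rfl⟩ := hqsurj y hyC
      rw [hp, hq] at hle
      exact Finset.mem_image_of_mem _ (Finset.mem_Iio.mpr (c.lt_iff_lt.mp (hle.trans_lt hlt)))
    have := hcount _ (hpR i)
    omega
  have hdet := ht _ r c r.strictMono c.strictMono hcr
  have hker : (fun j => a (q j)) = 0 := by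
    by_contra hne
    refine hdet (Matrix.exists_mulVec_eq_zero_iff.mp ⟨_, hne, ?_⟩)
    funext i
    rw [Pi.zero_apply, ← ha _ (hpR i)]
    refine Finset.sum_bij (fun j _ => q j) (fun j _ => hqC j) (fun _ _ _ _ h => hqinj h)
      (fun y hy => (hqsurj y hy).imp fun j hj => ⟨Finset.mem_univ _, hj⟩) fun j _ => ?_
    simp only [Matrix.of_apply, hp, hq]
  intro y hy
  obtain ⟨j, rfl⟩ := hqsurj y hy
  exact congrFun hker j

theorem eq_zero_of_card_le (ht : IsSuperregular t) {R : Finset ι} {C : Finset κ}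
    {ρ : ι → ℕ} {γ : κ → ℕ} (hρ : Set.InjOn ρ R) (hγ : Set.InjOn γ C)
    (hcard : C.card ≤ R.card) (hle : ∀ x ∈ R, ∀ y ∈ C, γ y ≤ ρ x)
    {a : κ → K} (ha : ∀ x ∈ R, ∑ y ∈ C, toeplitzEntry t (ρ x) (γ y) * a y = 0) :
    ∀ y ∈ C, a y = 0 := by
  obtain ⟨R', hR', hcard'⟩ := Finset.exists_subset_card_eq hcard
  refine ht.eq_zero_of_sum_eq_zero (hρ.mono hR') hγ hcard' (fun x hx => ?_)
    fun x hx => ha x (hR' hx)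
  rw [Finset.filter_true_of_mem fun y hy => hle x (hR' hx) y hy, ← hcard']
  exact Finset.card_filter_le _ _

theorem exists_sum_eq (ht : IsSuperregular t) {R : Finset ι} {C : Finset κ}
    {ρ : ι → ℕ} {γ : κ → ℕ} (hρ : Set.InjOn ρ R) (hγ : Set.InjOn γ C)
    (hcard : R.card ≤ C.card) (hle : ∀ x ∈ R, ∀ y ∈ C, γ y ≤ ρ x) (b : ι → K) :
    ∃ a : κ → K, (∀ y ∉ C, a y = 0) ∧
      ∀ x ∈ R, ∑ y ∈ C, toeplitzEntry t (ρ x) (γ y) * a y = b x := by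
  classical
  obtain ⟨C', hC', hcard'⟩ := Finset.exists_subset_card_eq hcard
  let M : Matrix R C' K := Matrix.of fun x y => toeplitzEntry t (ρ x) (γ y)
  have hinj : Function.Injective M.mulVecLin := by
    rw [← LinearMap.ker_eq_bot, LinearMap.ker_eq_bot']
    intro a ha
    have := ht.eq_zero_of_card_le hρ (hγ.mono hC') hcard'.le
      (fun x hx y hy => hle x hx y (hC' hy))
      (a := fun y => if h : y ∈ C' then a ⟨y, h⟩ else 0) (fun x hx => by
        rw [← Finset.sum_coe_sort C']
        simpa [M, Matrix.mulVec, dotProduct] using congrFun ha ⟨x, hx⟩)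
    funext y
    simpa using this y y.2
  obtain ⟨a, ha⟩ := (LinearMap.injective_iff_surjective_of_finrank_eq_finrank
    (by simp [hcard'])).mp hinj (fun x => b x)
  refine ⟨fun y => if h : y ∈ C' then a ⟨y, h⟩ else 0, fun y hy => ?_, fun x hx => ?_⟩
  · exact dif_neg fun h => hy (hC' h)
  · have := congrFun ha ⟨x, hx⟩
    rw [← Finset.sum_subset hC' fun y _ hy => by simp [hy],
      ← Finset.sum_coe_sort C']
    simpa [M, Matrix.mulVec, dotProduct] using this

end IsSuperregular

/-- A set `Z` of positions `(r, c)`, standing for the coefficient of `z ^ r` in coordinate `c`,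
is admissible for parameters `k` and `s` if it selects `s * k` rows in the first `s` row blocks of
the sliding generator matrix, and at most `r * k` of them in the first `r` blocks. -/
structure IsAdmissible {n : ℕ} (k s : ℕ) (Z : Finset (ℕ × Fin n)) : Prop where
  lt : ∀ z ∈ Z, z.1 < s
  card_eq : Z.card = s * k
  card_le : ∀ r ≤ s, (Z.filter fun z => z.1 < r).card ≤ r * k

/-- The square submatrices of the truncated sliding generator matrices of `G` given by admissible
row sets are nonsingular, expressed through their kernels. -/
def HasMDPMinors {K : Type*} [Field K] {n k : ℕ} (L : ℕ)
    (G : Matrix (Fin n) (Fin k) (PowerSeries K)) : Prop :=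
  ∀ s ≤ L + 1, ∀ Z : Finset (ℕ × Fin n), IsAdmissible k s Z → ∀ u : Fin k → PowerSeries K,
    (∀ z ∈ Z, PowerSeries.coeff z.1 (G.mulVec u z.2) = 0) →
      ∀ i < s, ∀ j, PowerSeries.coeff i (u j) = 0

theorem PowerSeries.coeff_mul_eq_sum_range {K : Type*} [CommSemiring K] {r s : ℕ} (hrs : r < s)
    (f g : PowerSeries K) : PowerSeries.coeff r (f * g) =
      ∑ i ∈ Finset.range s, (if i ≤ r then PowerSeries.coeff (r - i) f else 0) *
        PowerSeries.coeff i g := by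
  rw [mul_comm f g, PowerSeries.coeff_mul, Finset.Nat.sum_antidiagonal_eq_sum_range_succ_mk]
  refine (Finset.sum_congr rfl fun i hi => ?_).trans
    (Finset.sum_subset (Finset.range_subset_range.mpr hrs) fun i _ hi => ?_)
  · rw [if_pos (Finset.mem_range_succ_iff.mp hi), mul_comm]
  · rw [if_neg (by rwa [Finset.mem_range_succ_iff] at hi), zero_mul]

/-- The systematic encoder whose parity part interleaves the Toeplitz matrix of `t`. -/
noncomputable def systematicEncoder {K : Type*} [Field K] (n k : ℕ) (t : ℕ → K) :
    Matrix (Fin n) (Fin k) (PowerSeries K) :=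
  fun c b => if (c : ℕ) < k then (if (c : ℕ) = b then 1 else 0)
    else PowerSeries.mk fun d => t (d * n + c - 1 - b)

section Systematic

variable {K : Type*} [Field K] {n k : ℕ} {t : ℕ → K}

theorem systematicEncoder_mulVec_of_lt (w : Fin k → PowerSeries K) {c : Fin n}
    (hc : (c : ℕ) < k) : (systematicEncoder n k t).mulVec w c = w ⟨c, hc⟩ := by
  rw [Matrix.mulVec, dotProduct, Finset.sum_eq_single ⟨c, hc⟩]
  · simp [systematicEncoder, hc]
  · intro b _ hb
    have : (c : ℕ) ≠ b := fun h => hb (Fin.ext h.symm)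
    simp [systematicEncoder, hc, this]
  · simp

theorem coeff_systematicEncoder_mulVec (w : Fin k → PowerSeries K) {c : Fin n}
    (hc : k ≤ (c : ℕ)) {r s : ℕ} (hrs : r < s) :
    PowerSeries.coeff r ((systematicEncoder n k t).mulVec w c) =
      ∑ y ∈ Finset.range s ×ˢ (Finset.univ : Finset (Fin k)),
        toeplitzEntry t (r * n + c - 1) (y.1 * n + y.2) * PowerSeries.coeff y.1 (w y.2) := by
  rw [Matrix.mulVec, dotProduct, map_sum, Finset.sum_product_right]
  refine Finset.sum_congr rfl fun b _ => ?_
  rw [PowerSeries.coeff_mul_eq_sum_range hrs]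
  refine Finset.sum_congr rfl fun i _ => ?_
  congr 1
  have hb := b.2
  have hcn := c.2
  simp only [systematicEncoder, if_neg (not_lt.mpr hc), PowerSeries.coeff_mk, toeplitzEntry]
  by_cases hir : i ≤ r
  · obtain ⟨d, rfl⟩ := Nat.exists_eq_add_of_le hir
    rw [if_pos hir, if_pos (by rw [add_mul]; omega), Nat.add_sub_cancel_left]
    congr 1
    rw [add_mul]
    omega
  · rw [if_neg hir, if_neg]
    have : (r + 1) * n ≤ i * n := Nat.mul_le_mul_right n (by omega)
    rw [add_mul] at this
    omega

theorem mul_add_val_injective : Function.Injective fun y : ℕ × Fin n => y.1 * n + y.2 := by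
  rintro ⟨i, b⟩ ⟨i', b'⟩ h
  obtain hlt | rfl | hlt := lt_trichotomy i i'
  · have := Nat.mul_le_mul_right n hlt
    simp only [Nat.succ_eq_add_one, add_mul] at this h
    omega
  · exact Prod.ext rfl (Fin.ext (by simpa using h))
  · have := Nat.mul_le_mul_right n hlt
    simp only [Nat.succ_eq_add_one, add_mul] at this h
    omega

theorem columnIndex_injective (hkn : k ≤ n) :
    Function.Injective fun y : ℕ × Fin k => y.1 * n + y.2 := fun y y' h => by
  have := mul_add_val_injective (n := n) (a₁ := (y.1, Fin.castLE hkn y.2))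
    (a₂ := (y'.1, Fin.castLE hkn y'.2)) h
  rw [Prod.mk.injEq] at this
  exact Prod.ext this.1 (Fin.castLE_injective hkn this.2)

theorem rowIndex_injOn (hk : 0 < k) :
    Set.InjOn (fun z : ℕ × Fin n => z.1 * n + z.2 - 1) {z | k ≤ (z.2 : ℕ)} := fun z hz z' hz' h =>
  mul_add_val_injective (n := n) (by
    simp only [Set.mem_ofPred_eq] at hz hz' h ⊢
    omega)

theorem IsAdmissible.card_filter_parity_add {s : ℕ} {Z : Finset (ℕ × Fin n)} (hkn : k ≤ n) {r : ℕ}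
    (hr : r ≤ s) :
    ((Z.filter fun z => k ≤ (z.2 : ℕ)).filter fun z => z.1 < r).card + r * k =
      (Z.filter fun z => z.1 < r).card +
        (((Finset.range s ×ˢ (Finset.univ : Finset (Fin k))).filter fun y =>
          (y.1, Fin.castLE hkn y.2) ∉ Z).filter fun y => y.1 < r).card := by
  have h1 := Finset.card_filter_add_card_filter_not
    (s := Finset.range r ×ˢ (Finset.univ : Finset (Fin k)))
    (fun y => (y.1, Fin.castLE hkn y.2) ∈ Z)
  have h2 := Finset.card_filter_add_card_filter_not (s := Z.filter fun z => z.1 < r)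
    (fun z => k ≤ (z.2 : ℕ))
  have h3 : ((Finset.range r ×ˢ (Finset.univ : Finset (Fin k))).filter
      fun y => (y.1, Fin.castLE hkn y.2) ∈ Z).card =
      ((Z.filter fun z => z.1 < r).filter fun z => ¬ k ≤ (z.2 : ℕ)).card := by
    refine Finset.card_bij (fun y _ => (y.1, Fin.castLE hkn y.2)) ?_ ?_ ?_
    · intro y hy
      simp only [Finset.mem_filter, Finset.mem_product, Finset.mem_range] at hy ⊢
      exact ⟨⟨hy.2, hy.1.1⟩, by simp⟩
    · intro y _ y' _ h
      rw [Prod.mk.injEq] at h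
      exact Prod.ext h.1 (Fin.castLE_injective hkn h.2)
    · intro z hz
      simp only [Finset.mem_filter, not_le] at hz
      exact ⟨(z.1, ⟨z.2, hz.2⟩), by simp [hz.1.1, hz.1.2], rfl⟩
  have h4 : ((Finset.range s ×ˢ (Finset.univ : Finset (Fin k))).filter fun y =>
        (y.1, Fin.castLE hkn y.2) ∉ Z).filter (fun y => y.1 < r) =
      (Finset.range r ×ˢ (Finset.univ : Finset (Fin k))).filter
        fun y => (y.1, Fin.castLE hkn y.2) ∉ Z := by
    ext y
    simp only [Finset.mem_filter, Finset.mem_product, Finset.mem_range, Finset.mem_univ]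
    constructor
    · rintro ⟨⟨_, h⟩, h'⟩
      exact ⟨⟨h', trivial⟩, h⟩
    · rintro ⟨⟨h', _⟩, h⟩
      exact ⟨⟨⟨by omega, trivial⟩, h⟩, h'⟩
  rw [h4, Finset.filter_comm]
  simp only [Finset.card_product, Finset.card_range, Finset.card_univ, Fintype.card_fin] at h1
  omega

theorem IsSuperregular.hasMDPMinors_systematicEncoder (ht : IsSuperregular t) (hk : 0 < k)
    (hkn : k ≤ n) (L : ℕ) : HasMDPMinors L (systematicEncoder n k t) := by
  intro s _ Z hZ w hw
  have hsys : ∀ y : ℕ × Fin k, (y.1, Fin.castLE hkn y.2) ∈ Z →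
      PowerSeries.coeff y.1 (w y.2) = 0 := by
    intro y hy
    have := hw _ hy
    rwa [systematicEncoder_mulVec_of_lt w (c := Fin.castLE hkn y.2) y.2.2] at this
  set R := Z.filter fun z => k ≤ (z.2 : ℕ) with hR
  set C := (Finset.range s ×ˢ (Finset.univ : Finset (Fin k))).filter fun y =>
    (y.1, Fin.castLE hkn y.2) ∉ Z with hC
  have hcard : R.card = C.card := by
    have := IsAdmissible.card_filter_parity_add (Z := Z) hkn le_rfl (s := s)
    rw [← hR, ← hC, Finset.filter_true_of_mem (s := R)
      fun z hz => hZ.lt z (Finset.mem_filter.mp hz).1, Finset.filter_true_of_mem (s := Z) hZ.lt,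
      Finset.filter_true_of_mem (s := C) fun y hy => by
        simpa using (Finset.mem_product.mp (Finset.mem_filter.mp hy).1).1, hZ.card_eq] at this
    omega
  have key := ht.eq_zero_of_sum_eq_zero (R := R) (C := C)
    (ρ := fun z => z.1 * n + z.2 - 1) (γ := fun y => y.1 * n + y.2)
    ((rowIndex_injOn hk).mono fun z hz => (Finset.mem_filter.mp hz).2)
    (columnIndex_injective hkn).injOn hcard (fun x hx => ?_)
    (a := fun y => PowerSeries.coeff y.1 (w y.2)) (fun x hx => ?_)
  · intro i hi j
    by_cases hij : (i, Fin.castLE hkn j) ∈ Z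
    · exact hsys (i, j) hij
    · exact key (i, j) (Finset.mem_filter.mpr ⟨by simp [hi], hij⟩)
  · obtain ⟨hxZ, hxk⟩ := Finset.mem_filter.mp hx
    have hxs := hZ.lt x hxZ
    have h1 := IsAdmissible.card_filter_parity_add (Z := Z) hkn (r := x.1 + 1) hxs
    have h2 : (Z.filter fun z => z.1 < x.1 + 1).card ≤ (x.1 + 1) * k := hZ.card_le _ hxs
    rw [← hR, ← hC] at h1
    refine (Finset.card_le_card ?_).trans ((by omega : (R.filter fun z => z.1 < x.1 + 1).card ≤
      (C.filter fun y => y.1 < x.1 + 1).card).trans (Finset.card_le_card ?_))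
    · refine Finset.monotone_filter_right _ fun z _ hz => ?_
      by_contra! hlt
      have : (x.1 + 1) * n ≤ z.1 * n := Nat.mul_le_mul_right n hlt
      have := x.2.2
      rw [add_mul] at *
      omega
    · refine Finset.monotone_filter_right _ fun y _ hy => ?_
      have : y.1 * n ≤ x.1 * n := Nat.mul_le_mul_right n (by omega)
      have := y.2.2
      omega
  · obtain ⟨hxZ, hxk⟩ := Finset.mem_filter.mp hx
    rw [← hw x hxZ, coeff_systematicEncoder_mulVec w hxk (hZ.lt x hxZ)]
    refine Finset.sum_subset (Finset.filter_subset _ _) fun y hy hyC => ?_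
    rw [hsys y (by simpa [hC, Finset.mem_product.mp hy] using hyC), mul_zero]

end Systematic

/-- Multiplying an encoder by a matrix that is invertible at `0` preserves the minor condition. -/
theorem HasMDPMinors.of_mulVec {K : Type*} [Field K] {n k L : ℕ}
    {S G : Matrix (Fin n) (Fin k) (PowerSeries K)} (hS : HasMDPMinors L S)
    {B : Matrix (Fin k) (Fin k) (PowerSeries K)}
    (hB : (B.map (PowerSeries.coeff 0)).det ≠ 0)
    (hG : ∀ r ≤ L, ∀ c j, PowerSeries.coeff r (G c j) = PowerSeries.coeff r ((S * B) c j)) :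
    HasMDPMinors L G := by
  intro s hs Z hZ u hu
  have hw := hS s hs Z hZ (B.mulVec u) fun z hz => by
    rw [← hu z hz, Matrix.mulVec_mulVec, Matrix.mulVec, Matrix.mulVec, dotProduct, dotProduct,
      map_sum, map_sum]
    refine Finset.sum_congr rfl fun j _ => ?_
    rw [PowerSeries.coeff_mul, PowerSeries.coeff_mul]
    refine Finset.sum_congr rfl fun p hp => ?_
    rw [hG]
    have := Finset.HasAntidiagonal.mem_antidiagonal.mp hp
    have := hZ.lt z hz
    omega
  intro i
  induction i using Nat.strong_induction_on with
  | _ i ih =>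
  intro hi
  have hker : (fun j => PowerSeries.coeff i (u j)) = 0 := by
    by_contra hne
    refine hB (Matrix.exists_mulVec_eq_zero_iff.mp ⟨_, hne, ?_⟩)
    funext b
    rw [Pi.zero_apply, ← hw i hi b, Matrix.mulVec, Matrix.mulVec, dotProduct, dotProduct, map_sum]
    refine Finset.sum_congr rfl fun j _ => ?_
    rw [PowerSeries.coeff_mul, Finset.sum_eq_single (0, i)]
    · rfl
    · rintro ⟨p, q⟩ hpq hne
      rw [Finset.HasAntidiagonal.mem_antidiagonal] at hpq
      have hp : p ≠ 0 := by
        rintro rfl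
        exact hne (by simp_all)
      simp only at hpq ⊢
      rw [ih q (by omega) (by omega) j, mul_zero]
    · simp
  exact fun j => congrFun hker j

/-- The polynomial matrix whose `j`-th column has coefficients `g` and degree at most `D j`. -/
noncomputable def encoderMatrix {R : Type*} [Semiring R] {n k : ℕ} (D : Fin k → ℕ)
    (g : Fin n → Fin k → ℕ → R) : Matrix (Fin n) (Fin k) (Polynomial R) :=
  fun c j => ∑ i ∈ Finset.range (D j + 1), Polynomial.monomial i (g c j i)

theorem coeff_encoderMatrix {R : Type*} [Semiring R] {n k : ℕ} (D : Fin k → ℕ)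
    (g : Fin n → Fin k → ℕ → R) (c : Fin n) (j : Fin k) (i : ℕ) :
    (encoderMatrix D g c j).coeff i = if i ≤ D j then g c j i else 0 := by
  simp [encoderMatrix, Polynomial.coeff_monomial]

/-- A polynomial matrix viewed as a matrix of power series. -/
noncomputable def powerSeriesMatrix {R : Type*} [CommSemiring R] {n k : ℕ}
    (G : Matrix (Fin n) (Fin k) (Polynomial R)) : Matrix (Fin n) (Fin k) (PowerSeries R) :=
  G.map fun p => (p : PowerSeries R)

theorem exists_linearIndependent_mem {K V : Type*} [Field K] [AddCommGroup V] [Module K V]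
    [FiniteDimensional K V] (E : ℕ → Submodule K V) (q : ℕ)
    (hE : ∀ j < q, j < Module.finrank K (E j)) :
    ∃ v : Fin q → V, LinearIndependent K v ∧ ∀ j : Fin q, v j ∈ E j := by
  induction q with
  | zero => exact ⟨Fin.elim0, linearIndependent_empty_type, fun j => j.elim0⟩
  | succ q ih =>
    obtain ⟨v, hv, hvE⟩ := ih fun j hj => hE j (by omega)
    obtain ⟨x, hx, hxv⟩ : ∃ x ∈ E q, x ∉ Submodule.span K (Set.range v) := by
      by_contra! hle
      have h1 := Submodule.finrank_mono (fun x hx => hle x hx : E q ≤ _)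
      rw [finrank_span_eq_card hv, Fintype.card_fin] at h1
      exact absurd (hE q (by omega)) (by omega)
    refine ⟨Fin.snoc v x, linearIndependent_finSnoc.mpr ⟨hv, hxv⟩, fun j => ?_⟩
    refine Fin.lastCases ?_ (fun j => ?_) j
    · simpa using hx
    · simpa using hvE j

section Realization

variable {K : Type*} [Field K] (n k : ℕ) (t : ℕ → K)

/-- The positions of the parity coordinates at times `d + 1, …, L`. -/
def parityRows (d L : ℕ) : Finset (ℕ × Fin n) :=
  Finset.Ioc d L ×ˢ Finset.univ.filter fun c : Fin n => k ≤ (c : ℕ)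

/-- The parity coefficients at times `d + 1, …, L` as functions of the information sequence. -/
def parityMatrix (d L : ℕ) : Matrix (parityRows n k d L) (Fin (d + 1) × Fin k) K :=
  Matrix.of fun z y => toeplitzEntry t (z.1.1 * n + z.1.2 - 1) (y.1 * n + y.2)

/-- The constant terms of the information sequences of degree at most `d` whose parity
coefficients vanish at times `d + 1, …, L`. -/
noncomputable def initialSpace (d L : ℕ) : Submodule K (Fin k → K) :=
  LinearMap.range ((LinearMap.funLeft K K fun b : Fin k => ((0 : Fin (d + 1)), b)).domRestrict
    (LinearMap.ker (parityMatrix n k t d L).mulVecLin))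

variable {n k t}

theorem card_parityRows (hkn : k ≤ n) (d L : ℕ) :
    (parityRows n k d L).card = (L - d) * (n - k) := by
  have h1 : (Finset.univ.filter fun c : Fin n => k ≤ (c : ℕ)).card = n - k := by
    have := Finset.card_filter_add_card_filter_not (s := (Finset.univ : Finset (Fin n)))
      (fun c => (c : ℕ) < k)
    simp only [not_lt, Fin.card_filter_val_lt, Finset.card_univ, Fintype.card_fin] at this
    omega
  rw [parityRows, Finset.card_product, Nat.card_Ioc, h1]

theorem parityRows_injOn (hk : 0 < k) (d L : ℕ) :
    Set.InjOn (fun z : ℕ × Fin n => z.1 * n + z.2 - 1) (parityRows n k d L) :=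
  (rowIndex_injOn hk).mono fun _ hz =>
    (Finset.mem_filter.mp (Finset.mem_product.mp hz).2).2

theorem succColumnIndex_injective (hkn : k ≤ n) (d : ℕ) :
    Function.Injective fun y : Fin d × Fin k => (y.1 + 1 : ℕ) * n + y.2 := fun y y' h => by
  have := columnIndex_injective hkn (a₁ := ((y.1 : ℕ) + 1, y.2)) (a₂ := ((y'.1 : ℕ) + 1, y'.2)) h
  rw [Prod.mk.injEq] at this
  exact Prod.ext (Fin.ext (by omega)) this.2

theorem succColumnIndex_le {d L : ℕ} {z : ℕ × Fin n}
    (hz : z ∈ parityRows n k d L) (y : Fin d × Fin k) :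
    (y.1 + 1 : ℕ) * n + y.2 ≤ z.1 * n + z.2 - 1 := by
  obtain ⟨h1, h2⟩ := Finset.mem_product.mp hz
  have h3 := (Finset.mem_Ioc.mp h1).1
  have h4 := (Finset.mem_filter.mp h2).2
  have h5 := Nat.mul_le_mul_right n (by omega : (y.1 + 1 : ℕ) + 1 ≤ z.1)
  have := y.2.2
  rw [add_mul _ 1] at h5
  omega

theorem parityMatrix_mulVec (d L : ℕ) (β : Fin (d + 1) × Fin k → K)
    (z : parityRows n k d L) :
    (parityMatrix n k t d L).mulVec β z =
      ∑ b : Fin k, toeplitzEntry t (z.1.1 * n + z.1.2 - 1) b * β (0, b) +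
        ∑ y : Fin d × Fin k, toeplitzEntry t (z.1.1 * n + z.1.2 - 1) ((y.1 + 1) * n + y.2) *
          β (y.1.succ, y.2) := by
  rw [Matrix.mulVec, dotProduct, Fintype.sum_prod_type, Fin.sum_univ_succ, Fintype.sum_prod_type]
  simp [parityMatrix]

theorem initialSpace_eq_top (ht : IsSuperregular t) (hk : 0 < k) (hkn : k ≤ n) {d L : ℕ}
    (h : (L - d) * (n - k) ≤ d * k) : initialSpace n k t d L = ⊤ := by
  refine eq_top_iff.mpr fun b₀ _ => ?_
  obtain ⟨a, -, ha⟩ := ht.exists_sum_eq (C := (Finset.univ : Finset (Fin d × Fin k)))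
    (parityRows_injOn hk d L) (succColumnIndex_injective hkn d).injOn
    (by simpa [card_parityRows hkn] using h) (fun z hz y _ => succColumnIndex_le hz y)
    fun z => -∑ b : Fin k, toeplitzEntry t (z.1 * n + z.2 - 1) b * b₀ b
  refine ⟨⟨fun y => Fin.cases (b₀ y.2) (fun i => a (i, y.2)) y.1, ?_⟩, ?_⟩
  · rw [LinearMap.mem_ker]
    funext z
    rw [Matrix.mulVecLin_apply, parityMatrix_mulVec]
    have := ha z.1 z.2
    simp only [Fin.cases_zero, Fin.cases_succ, Prod.mk.eta, Pi.zero_apply]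
    rw [this, add_neg_cancel]
  · funext b
    simp [LinearMap.funLeft]

theorem le_finrank_initialSpace (ht : IsSuperregular t) (hk : 0 < k) (hkn : k ≤ n) {d L : ℕ}
    (h : d * k ≤ (L - d) * (n - k)) :
    (d + 1) * k ≤ Module.finrank K (initialSpace n k t d L) + (L - d) * (n - k) := by
  rw [initialSpace, LinearMap.finrank_range_of_inj]
  · have h1 := (parityMatrix n k t d L).mulVecLin.finrank_range_add_finrank_ker
    have h2 := (LinearMap.range (parityMatrix n k t d L).mulVecLin).finrank_le
    simp only [Module.finrank_fintype_fun_eq_card, Fintype.card_coe, card_parityRows hkn,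
      Fintype.card_prod, Fintype.card_fin] at h1 h2
    omega
  · rw [← LinearMap.ker_eq_bot, LinearMap.ker_eq_bot']
    rintro ⟨β, hβ⟩ h0
    have h0' : ∀ b, β (0, b) = 0 := fun b => congrFun h0 b
    rw [LinearMap.mem_ker] at hβ
    have key := ht.eq_zero_of_card_le (C := (Finset.univ : Finset (Fin d × Fin k)))
      (parityRows_injOn hk d L) (succColumnIndex_injective hkn d).injOn
      (by simpa [card_parityRows hkn] using h) (fun z hz y _ => succColumnIndex_le hz y)
      (a := fun y => β (y.1.succ, y.2)) fun z hz => by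
        have := congrFun hβ ⟨z, hz⟩
        rw [Matrix.mulVecLin_apply, parityMatrix_mulVec] at this
        simpa [h0'] using this
    refine Subtype.ext (funext fun y => ?_)
    obtain ⟨i, b⟩ := y
    refine Fin.cases (h0' b) (fun i => ?_) i
    exact key (i, b) (Finset.mem_univ _)

end Realization

/-- Generic column degrees of an encoder with `k` columns and total degree `δ`. -/
def genericColumnDegree (k δ : ℕ) (j : ℕ) : ℕ :=
  if j < k - δ % k then δ / k else δ / k + 1

theorem sum_genericColumnDegree {k : ℕ} (hk : 0 < k) (δ : ℕ) :
    ∑ j : Fin k, genericColumnDegree k δ j = δ := by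
  have h1 := Nat.mod_lt δ hk
  have h2 : ∀ j : Fin k, genericColumnDegree k δ j +
      (if (j : ℕ) < k - δ % k then 1 else 0) = δ / k + 1 := fun j => by
    unfold genericColumnDegree
    split_ifs <;> rfl
  have h3 : ∑ j : Fin k, genericColumnDegree k δ j +
      ∑ j : Fin k, (if (j : ℕ) < k - δ % k then 1 else 0) = k * (δ / k + 1) := by
    rw [← Finset.sum_add_distrib, Finset.sum_congr rfl fun j _ => h2 j]
    simp
  rw [Finset.sum_boole, Fin.card_filter_val_lt] at h3
  have := Nat.div_add_mod δ k
  rw [mul_add] at h3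
  simp only [Nat.cast_id] at h3
  omega

theorem IsSuperregular.exists_encoder {K : Type*} [Field K] {n k : ℕ} {t : ℕ → K}
    (ht : IsSuperregular t) (hk : 0 < k) (hkn : k < n) (δ : ℕ) :
    ∃ g : Fin n → Fin k → ℕ → K, HasMDPMinors (δ / k + δ / (n - k))
      (powerSeriesMatrix (encoderMatrix (fun j => genericColumnDegree k δ j) g)) := by
  set L := δ / k + δ / (n - k) with hL
  set D : ℕ → ℕ := genericColumnDegree k δ with hD
  have hmod := Nat.mod_lt δ hk
  have hdiv := Nat.div_add_mod δ k
  have hdiv' : δ / (n - k) * (n - k) ≤ δ := Nat.div_mul_le_self _ _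
  have hdim : ∀ j < k, j < Module.finrank K (initialSpace n k t (D j) L) := by
    intro j hj
    by_cases hjk : j < k - δ % k
    · rw [show D j = δ / k from if_pos hjk]
      rcases le_total ((L - δ / k) * (n - k)) (δ / k * k) with h | h
      · rw [initialSpace_eq_top ht hk hkn.le h]
        simpa using hj
      · have := le_finrank_initialSpace ht hk hkn.le h
        rw [show L - δ / k = δ / (n - k) from Nat.add_sub_cancel_left .., add_mul, one_mul] at this
        rw [mul_comm] at hdiv
        omega
    · rw [show D j = δ / k + 1 from if_neg hjk, initialSpace_eq_top ht hk hkn.le]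
      · simpa using hj
      · have h1 : L - (δ / k + 1) = δ / (n - k) - 1 := by omega
        rw [h1, Nat.sub_mul, add_mul, mul_comm (δ / k)]
        omega
  obtain ⟨v, hv, hvE⟩ := exists_linearIndependent_mem
    (fun j => initialSpace n k t (D j) L) k hdim
  choose β hβ using hvE
  let B : Matrix (Fin k) (Fin k) (PowerSeries K) := fun b j =>
    PowerSeries.mk fun i => if h : i < D j + 1 then (β j).1 (⟨i, h⟩, b) else 0
  have hB0 : B.map (PowerSeries.coeff 0) = Matrix.of fun b j => v j b := by
    ext b j
    change _ = v j b
    rw [← hβ j]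
    change PowerSeries.coeff 0 (B b j) = (β j).1 (0, b)
    rw [PowerSeries.coeff_mk]
    rfl
  have hBdet : (B.map (PowerSeries.coeff 0)).det ≠ 0 := by
    rw [hB0]
    refine ((Matrix.isUnit_iff_isUnit_det _).mp ?_).ne_zero
    exact Matrix.linearIndependent_cols_iff_isUnit.mp hv
  refine ⟨fun c j i => PowerSeries.coeff i ((systematicEncoder n k t * B) c j),
    (ht.hasMDPMinors_systematicEncoder hk hkn.le L).of_mulVec hBdet fun r hr c j => ?_⟩
  simp only [powerSeriesMatrix, Matrix.map_apply, Polynomial.coeff_coe, coeff_encoderMatrix]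
  split_ifs with hrD
  · rfl
  symm
  change PowerSeries.coeff r ((systematicEncoder n k t).mulVec (fun b => B b j) c) = 0
  rcases lt_or_ge (c : ℕ) k with hc | hc
  · rw [systematicEncoder_mulVec_of_lt _ hc]
    simp only [B, PowerSeries.coeff_mk]
    exact dif_neg (by omega)
  · rw [coeff_systematicEncoder_mulVec _ hc (Nat.lt_succ_self r), Finset.sum_product]
    have hker := congrFun (LinearMap.mem_ker.mp (β j).2) ⟨(r, c), by
      simp [parityRows, hc, hr]; omega⟩
    rw [Matrix.mulVecLin_apply, Matrix.mulVec, dotProduct, Fintype.sum_prod_type,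
      Pi.zero_apply] at hker
    rw [← hker, ← Finset.sum_subset (Finset.range_subset_range.mpr (by omega : D j + 1 ≤ r + 1)),
      Finset.sum_range]
    · refine Finset.sum_congr rfl fun i _ => Finset.sum_congr rfl fun b _ => ?_
      simp only [B, PowerSeries.coeff_mk, dif_pos i.2]
      rfl
    · intro i _ hi
      rw [Finset.mem_range] at hi
      exact Finset.sum_eq_zero fun b _ => by
        simp only [B, PowerSeries.coeff_mk, dif_neg hi, mul_zero]

/-- The square submatrix of the truncated sliding generator matrix of `encoderMatrix D x` with
`s` column blocks and rows given by `f`. -/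
noncomputable def slidingMinor {R : Type*} [CommRing R] {n k m : ℕ} (D : Fin k → ℕ)
    (x : Fin n → Fin k → ℕ → R) {s : ℕ} (f : Fin s × Fin k → Fin m × Fin n) :
    Matrix (Fin s × Fin k) (Fin s × Fin k) R :=
  Matrix.of fun a b => if (b.1 : ℕ) ≤ (f a).1 then
    (encoderMatrix D x (f a).2 b.2).coeff ((f a).1 - b.1) else 0

theorem map_slidingMinor {R S : Type*} [CommRing R] [CommRing S] (φ : R →+* S) {n k m : ℕ}
    (D : Fin k → ℕ) (x : Fin n → Fin k → ℕ → R) {s : ℕ} (f : Fin s × Fin k → Fin m × Fin n) :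
    φ (slidingMinor D x f).det = (slidingMinor D (fun c j i => φ (x c j i)) f).det := by
  rw [RingHom.map_det]
  congr 1
  ext a b
  simp only [slidingMinor, RingHom.mapMatrix_apply, Matrix.map_apply, Matrix.of_apply,
    coeff_encoderMatrix, apply_ite φ, map_zero]

/-- The set of positions selected by `f`. -/
def rowSet {n m : ℕ} {ι : Type*} [Fintype ι] (f : ι → Fin m × Fin n) : Finset (ℕ × Fin n) :=
  Finset.univ.image fun a => (((f a).1 : ℕ), (f a).2)

theorem slidingMinor_mulVec {K : Type*} [Field K] {n k m : ℕ} (D : Fin k → ℕ)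
    (g : Fin n → Fin k → ℕ → K) {s : ℕ} (f : Fin s × Fin k → Fin m × Fin n)
    (u : Fin k → PowerSeries K) (a : Fin s × Fin k) (ha : ((f a).1 : ℕ) < s) :
    (slidingMinor D g f).mulVec (fun b => PowerSeries.coeff b.1 (u b.2)) a =
      PowerSeries.coeff (f a).1 ((powerSeriesMatrix (encoderMatrix D g)).mulVec u (f a).2) := by
  rw [Matrix.mulVec, dotProduct, Fintype.sum_prod_type_right, Matrix.mulVec, dotProduct, map_sum]
  refine Finset.sum_congr rfl fun j _ => ?_
  rw [PowerSeries.coeff_mul_eq_sum_range ha, Finset.sum_range]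
  simp only [slidingMinor, Matrix.of_apply, powerSeriesMatrix, Matrix.map_apply,
    Polynomial.coeff_coe]

theorem hasMDPMinors_iff_det_ne_zero {K : Type*} [Field K] {n k : ℕ} (L : ℕ) (D : Fin k → ℕ)
    (g : Fin n → Fin k → ℕ → K) :
    HasMDPMinors L (powerSeriesMatrix (encoderMatrix D g)) ↔
      ∀ (s : Fin (L + 2)) (f : Fin s × Fin k → Fin (L + 1) × Fin n),
        IsAdmissible k s (rowSet f) → (slidingMinor D g f).det ≠ 0 := by
  constructor
  · intro h s f hf hdet
    obtain ⟨w, hw, hMw⟩ := Matrix.exists_mulVec_eq_zero_iff.mpr hdet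
    refine hw (funext fun b => ?_)
    let u : Fin k → PowerSeries K := fun j =>
      PowerSeries.mk fun i => if hi : i < s then w (⟨i, hi⟩, j) else 0
    have hwu : w = fun b => PowerSeries.coeff b.1 (u b.2) := by
      ext b
      simp [u]
    have := h s (by omega) (rowSet f) hf u (fun z hz => ?_) b.1 b.1.2 b.2
    · rw [hwu]
      exact this
    · have hlt := hf.lt z hz
      obtain ⟨a, -, rfl⟩ := Finset.mem_image.mp hz
      rw [← slidingMinor_mulVec D g f u a hlt, ← hwu, hMw, Pi.zero_apply]
  · intro h s hs Z hZ u hu i hi j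
    have hcard : Fintype.card (Fin s × Fin k) = Fintype.card Z := by
      rw [Fintype.card_coe, hZ.card_eq, Fintype.card_prod, Fintype.card_fin, Fintype.card_fin]
    let e := Fintype.equivOfCardEq hcard
    have hlt : ∀ a, (e a).1.1 < s := fun a => hZ.lt _ (e a).2
    let f : Fin s × Fin k → Fin (L + 1) × Fin n := fun a =>
      (⟨(e a).1.1, (hlt a).trans_le hs⟩, (e a).1.2)
    have hf : rowSet f = Z := by
      ext z
      simp only [rowSet, Finset.mem_image, Finset.mem_univ, true_and]
      constructor
      · rintro ⟨a, rfl⟩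
        exact (e a).2
      · intro hz
        exact ⟨e.symm ⟨z, hz⟩, by simp [f]⟩
    have hdet := h ⟨s, by omega⟩ f (by rwa [hf])
    have hzero := Matrix.eq_zero_of_mulVec_eq_zero hdet
      (v := fun b => PowerSeries.coeff b.1 (u b.2)) (funext fun a => by
        rw [slidingMinor_mulVec D g f u a (hlt a)]
        exact hu _ (e a).2)
    exact congrFun hzero (⟨i, hi⟩, j)

theorem MvPolynomial.exists_aeval_zmod_ne_zero {σ : Type*} {P : MvPolynomial σ ℤ} (hP : P ≠ 0) :
    ∃ (p : ℕ) (_ : Fact p.Prime) (x : σ → ZMod p), MvPolynomial.aeval x P ≠ 0 := by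
  obtain ⟨y, hy⟩ : ∃ y : σ → ℤ, MvPolynomial.eval y P ≠ 0 := by
    by_contra! h
    exact hP (MvPolynomial.funext fun y => by rw [h y, map_zero])
  obtain ⟨p, hp, hprime⟩ := Nat.exists_infinite_primes ((MvPolynomial.eval y P).natAbs + 1)
  refine ⟨p, ⟨hprime⟩, fun a => (y a : ZMod p), fun h => ?_⟩
  have h1 : MvPolynomial.aeval (fun a => (y a : ZMod p)) P =
      ((MvPolynomial.eval y P : ℤ) : ZMod p) := by
    rw [MvPolynomial.aeval_def, Subsingleton.elim (algebraMap ℤ (ZMod p)) (Int.castRingHom _)]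
    exact MvPolynomial.eval₂_comp_left (Int.castRingHom (ZMod p)) (RingHom.id ℤ) y P |>.symm
  rw [h1, ZMod.intCast_zmod_eq_zero_iff_dvd] at h
  have := Int.natAbs_dvd_natAbs.mpr h
  rw [Int.natAbs_natCast] at this
  have := Nat.le_of_dvd (Int.natAbs_pos.mpr hy) this
  omega

theorem exists_prime_hasMDPMinors {K : Type*} [Field K] {n k : ℕ} {L : ℕ} {D : Fin k → ℕ}
    {g : Fin n → Fin k → ℕ → K} (hg : HasMDPMinors L (powerSeriesMatrix (encoderMatrix D g))) :
    ∃ (p : ℕ) (_ : Fact p.Prime) (h : Fin n → Fin k → ℕ → ZMod p),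
      HasMDPMinors L (powerSeriesMatrix (encoderMatrix D h)) ∧
      HasMDPMinors L (powerSeriesMatrix (encoderMatrix D fun c j i => h c j (D j - i))) := by
  classical
  let A : Fin n → Fin k → ℕ → MvPolynomial (Fin n × Fin k × ℕ) ℤ :=
    fun c j i => MvPolynomial.X (c, j, i)
  let B : Fin n → Fin k → ℕ → MvPolynomial (Fin n × Fin k × ℕ) ℤ :=
    fun c j i => MvPolynomial.X (c, j, D j - i)
  have hA : ∀ (s : Fin (L + 2)) (f : Fin s × Fin k → Fin (L + 1) × Fin n),
      IsAdmissible k s (rowSet f) → (slidingMinor D A f).det ≠ 0 := by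
    intro s f hf h0
    refine (hasMDPMinors_iff_det_ne_zero L D g).mp hg s f hf ?_
    have := map_slidingMinor
      (MvPolynomial.aeval (R := ℤ) fun a : Fin n × Fin k × ℕ => g a.1 a.2.1 a.2.2).toRingHom D A f
    rw [h0, map_zero] at this
    simpa [A] using this.symm
  have hB : ∀ (s : Fin (L + 2)) (f : Fin s × Fin k → Fin (L + 1) × Fin n),
      IsAdmissible k s (rowSet f) → (slidingMinor D B f).det ≠ 0 := by
    intro s f hf h0
    refine (hasMDPMinors_iff_det_ne_zero L D g).mp hg s f hf ?_
    have := map_slidingMinor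
      (MvPolynomial.aeval (R := ℤ)
        fun a : Fin n × Fin k × ℕ => g a.1 a.2.1 (D a.2.1 - a.2.2)).toRingHom D B f
    rw [h0, map_zero] at this
    rw [this]
    congr 1
    ext a b
    simp only [slidingMinor, Matrix.of_apply, coeff_encoderMatrix]
    split_ifs with h1 h2
    · simp [B, Nat.sub_sub_self h2]
    · rfl
    · rfl
  obtain ⟨p, hp, x, hx⟩ := MvPolynomial.exists_aeval_zmod_ne_zero
    (P := ∏ q ∈ (Finset.univ : Finset (Σ s : Fin (L + 2),
        (Fin s × Fin k → Fin (L + 1) × Fin n))).filter fun q => IsAdmissible k q.1 (rowSet q.2),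
      (slidingMinor D A q.2).det * (slidingMinor D B q.2).det)
    (Finset.prod_ne_zero_iff.mpr fun q hq =>
      mul_ne_zero (hA q.1 q.2 (Finset.mem_filter.mp hq).2) (hB q.1 q.2 (Finset.mem_filter.mp hq).2))
  rw [map_prod, Finset.prod_ne_zero_iff] at hx
  have key : ∀ (s : Fin (L + 2)) (f : Fin s × Fin k → Fin (L + 1) × Fin n),
      IsAdmissible k s (rowSet f) →
        (slidingMinor D (fun c j i => x (c, j, i)) f).det ≠ 0 ∧
        (slidingMinor D (fun c j i => x (c, j, D j - i)) f).det ≠ 0 := by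
    intro s f hf
    have h := hx ⟨s, f⟩ (Finset.mem_filter.mpr ⟨Finset.mem_univ _, hf⟩)
    rw [map_mul] at h
    have h1 := map_slidingMinor (MvPolynomial.aeval (R := ℤ) x).toRingHom D A f
    have h2 := map_slidingMinor (MvPolynomial.aeval (R := ℤ) x).toRingHom D B f
    simp only [A, B, AlgHom.toRingHom_eq_coe, RingHom.coe_coe, MvPolynomial.aeval_X] at h1 h2
    rw [← h1, ← h2]
    exact ⟨left_ne_zero_of_mul h, right_ne_zero_of_mul h⟩
  exact ⟨p, hp, fun c j i => x (c, j, i),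
    (hasMDPMinors_iff_det_ne_zero L D _).mpr fun s f hf => (key s f hf).1,
    (hasMDPMinors_iff_det_ne_zero L D _).mpr fun s f hf => (key s f hf).2⟩

theorem exists_isAdmissible {n k S : ℕ} {Z₀ : Finset (ℕ × Fin n)} (hS : 0 < S)
    (h : S * k ≤ (Z₀.filter fun z => z.1 < S).card) :
    ∃ s, 0 < s ∧ s ≤ S ∧ ∃ Z ⊆ Z₀, IsAdmissible k s Z := by
  classical
  have hex : ∃ s, 0 < s ∧ s * k ≤ (Z₀.filter fun z => z.1 < s).card := ⟨S, hS, h⟩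
  obtain ⟨hpos, hle⟩ := Nat.find_spec hex
  have hmin : ∀ r < Nat.find hex, (Z₀.filter fun z => z.1 < r).card ≤ r * k := by
    intro r hr
    rcases Nat.eq_zero_or_pos r with rfl | hr0
    · simp
    · have := Nat.find_min hex hr
      push Not at this
      exact (this hr0).le
  obtain ⟨Z, hZ, hcard⟩ := Finset.exists_subset_card_eq hle
  refine ⟨Nat.find hex, hpos, Nat.find_min' hex ⟨hS, h⟩, Z,
    hZ.trans (Finset.filter_subset _ _),
    ⟨fun z hz => (Finset.mem_filter.mp (hZ hz)).2, hcard, fun r hr => ?_⟩⟩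
  rcases hr.lt_or_eq with hr | rfl
  · exact (Finset.card_le_card (Finset.filter_subset_filter _
      (hZ.trans (Finset.filter_subset _ _)))).trans (hmin r hr)
  · exact (Finset.card_filter_le _ _).trans hcard.le

theorem truncWeight_eq_card {F : Type*} [Semiring F] [DecidableEq F] {n : ℕ} (j : ℕ)
    (v : Fin n → Polynomial F) :
    truncWeight j v = ((Finset.range (j + 1) ×ˢ (Finset.univ : Finset (Fin n))).filter
      fun z => (v z.2).coeff z.1 ≠ 0).card := by
  rw [truncWeight, Finset.card_filter, Finset.sum_product_right]
  refine Finset.sum_congr rfl fun c _ => ?_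
  rw [← Finset.card_filter]
  congr 1
  ext i
  simp [and_comm]

theorem powerSeriesMatrix_mulVec {R : Type*} [CommSemiring R] {n k : ℕ}
    (G : Matrix (Fin n) (Fin k) (Polynomial R)) (u : Fin k → Polynomial R) (c : Fin n) :
    (powerSeriesMatrix G).mulVec (fun j => (u j : PowerSeries R)) c =
      (G.mulVec u c : Polynomial R) :=
  (map_sum (Polynomial.coeToPowerSeries.ringHom (R := R)) (fun j => G c j * u j)
      Finset.univ).trans
    (Finset.sum_congr rfl fun _ _ => map_mul (Polynomial.coeToPowerSeries.ringHom (R := R)) _ _)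
    |>.symm

section ColumnDistance

variable {F : Type*} [Field F] {n k L : ℕ}

theorem HasMDPMinors.le_truncWeight {G : Matrix (Fin n) (Fin k) (Polynomial F)}
    (hG : HasMDPMinors L (powerSeriesMatrix G)) (hkn : k < n) {u : Fin k → Polynomial F}
    (hu : (fun c => (G.mulVec u c).coeff 0) ≠ 0) :
    (n - k) * (L + 1) + 1 ≤ truncWeight L (G.mulVec u) := by
  classical
  by_contra! hlt
  rw [truncWeight_eq_card] at hlt
  set Q := Finset.range (L + 1) ×ˢ (Finset.univ : Finset (Fin n)) with hQ
  set Z₀ := Q.filter fun z => (G.mulVec u z.2).coeff z.1 = 0 with hZ₀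
  have hsum := Finset.card_filter_add_card_filter_not (s := Q)
    fun z => (G.mulVec u z.2).coeff z.1 = 0
  have hcardQ : Q.card = (L + 1) * n := by simp [hQ]
  have hZcard : (L + 1) * k ≤ (Z₀.filter fun z => z.1 < L + 1).card := by
    have hfilter : (Z₀.filter fun z => z.1 < L + 1) = Z₀ := Finset.filter_true_of_mem fun z hz =>
      Finset.mem_range.mp (Finset.mem_product.mp (Finset.mem_filter.mp hz).1).1
    rw [hfilter]
    have h1 : (L + 1) * n = (n - k) * (L + 1) + (L + 1) * k := by
      rw [mul_comm (n - k), ← mul_add, Nat.sub_add_cancel hkn.le]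
    simp only [← ne_eq, ← hZ₀] at hsum
    omega
  obtain ⟨s, hs, hsL, Z, hZ, hadm⟩ := exists_isAdmissible L.succ_pos hZcard
  have hzero := hG s hsL Z hadm (fun j => (u j : PowerSeries F)) fun z hz => by
    rw [powerSeriesMatrix_mulVec, Polynomial.coeff_coe]
    exact (Finset.mem_filter.mp (hZ hz)).2
  refine hu (funext fun c => ?_)
  rw [Matrix.mulVec, dotProduct, Polynomial.finsetSum_coeff]
  refine Finset.sum_eq_zero fun j _ => ?_
  have := hzero 0 hs j
  rw [Polynomial.coeff_coe] at this
  rw [Polynomial.mul_coeff_zero, this, mul_zero]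

theorem HasMDPMinors.exists_truncWeight_le {D : Fin k → ℕ} {g : Fin n → Fin k → ℕ → F}
    (hG : HasMDPMinors L (powerSeriesMatrix (encoderMatrix D g))) (hk : 0 < k) (hkn : k < n) :
    ∃ u : Fin k → Polynomial F, (fun c => ((encoderMatrix D g).mulVec u c).coeff 0) ≠ 0 ∧
      truncWeight L ((encoderMatrix D g).mulVec u) ≤ (n - k) * (L + 1) + 1 := by
  classical
  let f : Fin (L + 1) × Fin k → Fin (L + 1) × Fin n := Prod.map id (Fin.castLE hkn.le)
  have hfr : ∀ r ≤ L + 1, ((rowSet f).filter fun z => z.1 < r).card ≤ r * k := by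
    intro r _
    refine (Finset.card_le_card (t := Finset.range r ×ˢ
      (Finset.univ : Finset (Fin k)).map (Fin.castLEEmb hkn.le)) fun z hz => ?_).trans ?_
    · obtain ⟨hz, hzr⟩ := Finset.mem_filter.mp hz
      obtain ⟨a, -, rfl⟩ := Finset.mem_image.mp hz
      exact Finset.mem_product.mpr ⟨Finset.mem_range.mpr hzr,
        Finset.mem_map_of_mem _ (Finset.mem_univ a.2)⟩
    · simp
  have hf : IsAdmissible k (L + 1) (rowSet f) := by
    refine ⟨fun z hz => ?_, ?_, hfr⟩
    · obtain ⟨a, -, rfl⟩ := Finset.mem_image.mp hz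
      exact (f a).1.2
    · rw [rowSet, Finset.card_image_of_injective, Finset.card_univ, Fintype.card_prod,
        Fintype.card_fin, Fintype.card_fin]
      intro a b hab
      rw [Prod.mk.injEq] at hab
      exact Prod.ext (Fin.ext hab.1) (Fin.castLE_injective hkn.le hab.2)
  have hdet : (slidingMinor D g f).det ≠ 0 :=
    (hasMDPMinors_iff_det_ne_zero L D g).mp hG ⟨L + 1, by omega⟩ f hf
  set w := (slidingMinor D g f)⁻¹.mulVec (Pi.single ((0 : Fin (L + 1)), (⟨0, hk⟩ : Fin k)) 1)
    with hw
  let u : Fin k → Polynomial F := fun j => ∑ i : Fin (L + 1), Polynomial.monomial i (w (i, j))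
  have hu : (fun b : Fin (L + 1) × Fin k =>
      PowerSeries.coeff b.1 (u b.2 : PowerSeries F)) = w := by
    ext b
    simp [u, Polynomial.coeff_monomial, Fin.val_inj]
  have hcoeff : ∀ a : Fin (L + 1) × Fin k,
      ((encoderMatrix D g).mulVec u (Fin.castLE hkn.le a.2)).coeff a.1 =
        (Pi.single ((0 : Fin (L + 1)), (⟨0, hk⟩ : Fin k)) 1 : Fin (L + 1) × Fin k → F) a := by
    intro a
    have := slidingMinor_mulVec D g f (fun j => (u j : PowerSeries F)) a (f a).1.2
    rw [hu, hw, Matrix.mulVec_mulVec, Matrix.mul_nonsing_inv _ (isUnit_iff_ne_zero.mpr hdet),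
      Matrix.one_mulVec, powerSeriesMatrix_mulVec, Polynomial.coeff_coe] at this
    exact this.symm
  refine ⟨u, fun h => ?_, ?_⟩
  · have h1 := hcoeff (0, ⟨0, hk⟩)
    rw [Pi.single_eq_same] at h1
    exact one_ne_zero (h1.symm.trans (congrFun h _))
  · rw [truncWeight_eq_card]
    refine (Finset.card_le_card (t := insert (0, Fin.castLE hkn.le ⟨0, hk⟩)
      (Finset.range (L + 1) ×ˢ (Finset.univ.filter fun c : Fin n => ¬ (c : ℕ) < k)))
      fun z hz => ?_).trans ((Finset.card_insert_le _ _).trans ?_)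
    · obtain ⟨hzQ, hz⟩ := Finset.mem_filter.mp hz
      have hzL := (Finset.mem_product.mp hzQ).1
      by_cases hzk : (z.2 : ℕ) < k
      · have h1 := hcoeff (⟨z.1, Finset.mem_range.mp hzL⟩, ⟨z.2, hzk⟩)
        have h2 : ((⟨z.1, Finset.mem_range.mp hzL⟩, ⟨z.2, hzk⟩) : Fin (L + 1) × Fin k) =
            (0, ⟨0, hk⟩) := by
          by_contra h3
          exact hz (h1.trans (Pi.single_eq_of_ne h3 _))
        rw [Prod.mk.injEq, Fin.ext_iff, Fin.ext_iff] at h2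
        exact Finset.mem_insert.mpr (Or.inl (Prod.ext h2.1 (Fin.ext h2.2)))
      · exact Finset.mem_insert_of_mem
          (Finset.mem_product.mpr ⟨hzL, Finset.mem_filter.mpr ⟨Finset.mem_univ _, hzk⟩⟩)
    · have := Finset.card_filter_add_card_filter_not (s := (Finset.univ : Finset (Fin n)))
        (fun c => (c : ℕ) < k)
      rw [Fin.card_filter_val_lt, Finset.card_univ, Fintype.card_fin, min_eq_right hkn.le] at this
      rw [Finset.card_product, Finset.card_range, mul_comm, show Finset.card _ = n - k by omega]

theorem HasMDPMinors.isColDist {D : Fin k → ℕ} {g : Fin n → Fin k → ℕ → F}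
    (hG : HasMDPMinors L (powerSeriesMatrix (encoderMatrix D g))) (hk : 0 < k) (hkn : k < n) :
    IsColDist {v | ∃ u : Fin k → Polynomial F, v = (encoderMatrix D g).mulVec u} L
      ((n - k) * (L + 1) + 1) := by
  constructor
  · obtain ⟨u, hu, hle⟩ := hG.exists_truncWeight_le hk hkn
    exact ⟨_, ⟨u, rfl⟩, hu, hle.antisymm (hG.le_truncWeight hkn hu)⟩
  · rintro _ ⟨_, ⟨u, rfl⟩, hu, rfl⟩
    exact hG.le_truncWeight hkn hu

end ColumnDistance

section Reverse

variable {F : Type*} [Field F] {n k L : ℕ}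

theorem HasMDPMinors.eq_zero_of_constantCoeff {G : Matrix (Fin n) (Fin k) (PowerSeries F)}
    (hG : HasMDPMinors L G) (e : Fin k ↪ Fin n) {w : Fin k → F}
    (hw : ∀ i, ∑ j, PowerSeries.coeff 0 (G (e i) j) * w j = 0) : w = 0 := by
  classical
  have hadm : IsAdmissible k 1 (Finset.univ.image fun i => ((0 : ℕ), e i)) := by
    refine ⟨fun z hz => ?_, ?_, fun r hr => ?_⟩
    · obtain ⟨i, -, rfl⟩ := Finset.mem_image.mp hz
      exact one_pos
    · rw [Finset.card_image_of_injective _ fun a b hab => e.injective (Prod.ext_iff.mp hab).2]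
      simp
    · interval_cases r
      · simp
      · exact (Finset.card_filter_le _ _).trans (Finset.card_image_le.trans (by simp))
  funext j
  have := hG 1 (by omega) _ hadm (fun j => PowerSeries.C (w j)) (fun z hz => ?_) 0 one_pos j
  · simpa using this
  · obtain ⟨i, -, rfl⟩ := Finset.mem_image.mp hz
    rw [Matrix.mulVec, dotProduct, map_sum, ← hw i]
    exact Finset.sum_congr rfl fun j _ => PowerSeries.coeff_mul_C ..

theorem natDegree_encoderMatrix_le (D : Fin k → ℕ) (g : Fin n → Fin k → ℕ → F) (c : Fin n)
    (j : Fin k) : (encoderMatrix D g c j).natDegree ≤ D j := by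
  rw [Polynomial.natDegree_le_iff_coeff_eq_zero]
  intro i hi
  rw [coeff_encoderMatrix, if_neg (not_le.mpr hi)]

theorem reflect_encoderMatrix (D : Fin k → ℕ) (g : Fin n → Fin k → ℕ → F) (c : Fin n)
    (j : Fin k) : (encoderMatrix D g c j).reflect (D j) =
      encoderMatrix D (fun c j i => g c j (D j - i)) c j := by
  ext i
  rw [Polynomial.coeff_reflect, coeff_encoderMatrix, coeff_encoderMatrix]
  rcases le_or_gt i (D j) with h | h
  · rw [Polynomial.revAt_le h, if_pos h, if_pos (Nat.sub_le _ _)]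
  · rw [Polynomial.revAt_eq_self_of_lt h, if_neg (not_le.mpr h), if_neg (not_le.mpr h)]

theorem reflect_encoderMatrix_mulVec {D : Fin k → ℕ} (g : Fin n → Fin k → ℕ → F)
    {u : Fin k → Polynomial F} {s : ℕ} (hu : ∀ j, u j ≠ 0 → D j + (u j).natDegree ≤ s)
    (c : Fin n) : ((encoderMatrix D g).mulVec u c).reflect s =
      (encoderMatrix D fun c j i => g c j (D j - i)).mulVec
        (fun j => (u j).reflect (s - D j)) c := by
  have hsum : ((encoderMatrix D g).mulVec u c).reflect s =
      ∑ j, (encoderMatrix D g c j * u j).reflect s := by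
    ext i
    simp [Matrix.mulVec, dotProduct, Polynomial.finsetSum_coeff]
  rw [hsum]
  refine Finset.sum_congr rfl fun j _ => ?_
  rcases eq_or_ne (u j) 0 with h0 | h0
  · simp [h0]
  have := hu j h0
  change _ = encoderMatrix D (fun c j i => g c j (D j - i)) c j * (u j).reflect (s - D j)
  rw [← reflect_encoderMatrix, ← Polynomial.reflect_mul _ _ (natDegree_encoderMatrix_le D g c j)
    (by omega : (u j).natDegree ≤ s - D j), Nat.add_sub_cancel' (by omega)]

/-- The predictable degree property of `encoderMatrix D g`. -/
theorem add_natDegree_le_of_natDegree_mulVec_le {D : Fin k → ℕ} {g : Fin n → Fin k → ℕ → F}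
    (hlead : ∀ w : Fin k → F, (∀ c, ∑ j, g c j (D j) * w j = 0) → w = 0)
    {u : Fin k → Polynomial F} {s : ℕ}
    (hs : ∀ c, ((encoderMatrix D g).mulVec u c).natDegree ≤ s) (j : Fin k) (hj : u j ≠ 0) :
    D j + (u j).natDegree ≤ s := by
  classical
  by_contra! hlt
  obtain ⟨a, ha, hmax⟩ := Finset.exists_max_image (Finset.univ.filter fun j => u j ≠ 0)
    (fun j => D j + (u j).natDegree) ⟨j, by simpa using hj⟩
  have ha0 : u a ≠ 0 := (Finset.mem_filter.mp ha).2
  have hle : ∀ b, u b ≠ 0 → D b + (u b).natDegree ≤ D a + (u a).natDegree := fun b hb =>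
    hmax b (by simpa using hb)
  set M := D a + (u a).natDegree with hM
  have hw := hlead (fun b => if u b = 0 then 0 else (u b).coeff (M - D b)) fun c => ?_
  · have := congrFun hw a
    simp only [if_neg ha0, Pi.zero_apply, hM, Nat.add_sub_cancel_left,
      Polynomial.coeff_natDegree, Polynomial.leadingCoeff_eq_zero] at this
    exact ha0 this
  · have h0 : ((encoderMatrix D g).mulVec u c).coeff M = 0 :=
      Polynomial.coeff_eq_zero_of_natDegree_lt (((hs c).trans_lt hlt).trans_le (hle j hj))
    rw [Matrix.mulVec, dotProduct, Polynomial.finsetSum_coeff] at h0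
    refine (Finset.sum_congr rfl fun b _ => ?_).trans h0
    split_ifs with hb
    · simp [hb]
    · have hbM := hle b hb
      have := Polynomial.coeff_mul_add_eq_of_natDegree_le (natDegree_encoderMatrix_le D g c b)
        (by omega : (u b).natDegree ≤ M - D b)
      rw [Nat.add_sub_cancel' (by omega), coeff_encoderMatrix, if_pos le_rfl] at this
      exact this.symm

theorem revCode_encoderMatrix {D : Fin k → ℕ} {g : Fin n → Fin k → ℕ → F}
    (hlead : ∀ w : Fin k → F, (∀ c, ∑ j, g c j (D j) * w j = 0) → w = 0) :
    revCode {v | ∃ u : Fin k → Polynomial F, v = (encoderMatrix D g).mulVec u} =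
      {v | ∃ u : Fin k → Polynomial F,
        v = (encoderMatrix D fun c j i => g c j (D j - i)).mulVec u} := by
  ext w
  constructor
  · rintro ⟨_, ⟨u, rfl⟩, s, hs, rfl⟩
    exact ⟨_, funext (reflect_encoderMatrix_mulVec g
      (add_natDegree_le_of_natDegree_mulVec_le hlead hs))⟩
  · rintro ⟨u, rfl⟩
    set S := ∑ j, (D j + (u j).natDegree) with hS
    have hle : ∀ j, D j + (u j).natDegree ≤ S := fun j =>
      Finset.single_le_sum (f := fun j => D j + (u j).natDegree) (fun _ _ => Nat.zero_le _)
        (Finset.mem_univ j)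
    set g' : Fin n → Fin k → ℕ → F := fun c j i => g c j (D j - i) with hg'
    have hgg : encoderMatrix D (fun c j i => g' c j (D j - i)) = encoderMatrix D g := by
      ext c j i
      rw [coeff_encoderMatrix, coeff_encoderMatrix]
      split_ifs with hi
      · simp only [hg', Nat.sub_sub_self hi]
      · rfl
    refine ⟨fun c => ((encoderMatrix D g').mulVec u c).reflect S,
      ⟨_, (funext (reflect_encoderMatrix_mulVec g' fun j _ => hle j)).trans (by rw [hgg])⟩, S,
      fun c => Polynomial.natDegree_reflect_le.trans (max_le le_rfl ?_), ?_⟩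
    · rw [Matrix.mulVec, dotProduct]
      refine Polynomial.natDegree_sum_le_of_forall_le _ _ fun j _ => ?_
      exact (Polynomial.natDegree_mul_le_of_le (natDegree_encoderMatrix_le D g' c j) le_rfl).trans
        (hle j)
    · simp only [Polynomial.reflect_reflect]

end Reverse

section Degree

theorem Polynomial.coeff_prod_sum_of_natDegree_le {R ι : Type*} [CommSemiring R] (s : Finset ι)
    (f : ι → Polynomial R) (d : ι → ℕ) (h : ∀ i ∈ s, (f i).natDegree ≤ d i) :
    (∏ i ∈ s, f i).coeff (∑ i ∈ s, d i) = ∏ i ∈ s, (f i).coeff (d i) := by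
  classical
  induction s using Finset.induction_on with
  | empty => simp
  | insert a s ha ih =>
    rw [Finset.prod_insert ha, Finset.sum_insert ha, Finset.prod_insert ha,
      Polynomial.coeff_mul_add_eq_of_natDegree_le (h a (Finset.mem_insert_self a s))
        ((Polynomial.natDegree_prod_le _ _).trans
          (Finset.sum_le_sum fun i hi => h i (Finset.mem_insert_of_mem hi))),
      ih fun i hi => h i (Finset.mem_insert_of_mem hi)]

variable {R ι : Type*} [CommRing R] [Fintype ι] [DecidableEq ι]

theorem Matrix.natDegree_det_le_sum {A : Matrix ι ι (Polynomial R)} {d : ι → ℕ}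
    (h : ∀ i j, (A i j).natDegree ≤ d j) : A.det.natDegree ≤ ∑ j, d j := by
  rw [Matrix.det_apply]
  refine Polynomial.natDegree_sum_le_of_forall_le _ _ fun σ _ => ?_
  refine (Polynomial.natDegree_smul_le _ _).trans ((Polynomial.natDegree_prod_le _ _).trans ?_)
  exact Finset.sum_le_sum fun i _ => h _ i

theorem Matrix.coeff_det_sum {A : Matrix ι ι (Polynomial R)} {d : ι → ℕ}
    (h : ∀ i j, (A i j).natDegree ≤ d j) :
    A.det.coeff (∑ j, d j) = (Matrix.of fun i j => (A i j).coeff (d j)).det := by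
  rw [Matrix.det_apply, Matrix.det_apply, Polynomial.finsetSum_coeff]
  refine Finset.sum_congr rfl fun σ _ => ?_
  rw [Polynomial.coeff_smul,
    Polynomial.coeff_prod_sum_of_natDegree_le _ _ _ fun i _ => h (σ i) i]
  rfl

end Degree

theorem HasMDPMinors.det_submatrix_encoderMatrix {F : Type*} [Field F] {n k L : ℕ} {D : Fin k → ℕ}
    {g : Fin n → Fin k → ℕ → F}
    (h : HasMDPMinors L (powerSeriesMatrix (encoderMatrix D fun c j i => g c j (D j - i))))
    (e : Fin k ↪ Fin n) :
    ((encoderMatrix D g).submatrix e id).det ≠ 0 ∧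
      ((encoderMatrix D g).submatrix e id).det.natDegree = ∑ j, D j := by
  have hdeg : ∀ i j, ((encoderMatrix D g).submatrix e id i j).natDegree ≤ D j := fun i j =>
    natDegree_encoderMatrix_le D g (e i) j
  have hcoeff : ((encoderMatrix D g).submatrix e id).det.coeff (∑ j, D j) ≠ 0 := by
    rw [Matrix.coeff_det_sum hdeg]
    intro h0
    obtain ⟨w, hw, hMw⟩ := Matrix.exists_mulVec_eq_zero_iff.mpr h0
    refine hw (h.eq_zero_of_constantCoeff e fun i => ?_)
    refine (Finset.sum_congr rfl fun j _ => ?_).trans (congrFun hMw i)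
    simp [powerSeriesMatrix, coeff_encoderMatrix]
  exact ⟨fun h0 => hcoeff (by rw [h0, Polynomial.coeff_zero]),
    (Matrix.natDegree_det_le_sum hdeg).antisymm (Polynomial.le_natDegree_of_ne_zero hcoeff)⟩

/-- for all positive `k < n` and positive `δ` there exists a finite field `F`
and an `(n,k,δ)` reverse-MDP convolutional code over `F`. -/
theorem stmt_4 (n k δ : ℕ) (hk : 0 < k) (hδ : 0 < δ) (hkn : k < n) :
    ∃ (F : Type) (instF : Field F) (instFin : Fintype F),
      @ExistsReverseMDPCode F instF instFin n k δ := by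
  obtain ⟨K, _, t, ht⟩ := exists_isSuperregular
  obtain ⟨g₀, hg₀⟩ := ht.exists_encoder hk hkn δ
  obtain ⟨p, hp, g, hg, hgrev⟩ := exists_prime_hasMDPMinors hg₀
  have hdet := fun e => hgrev.det_submatrix_encoderMatrix (g := g) e
  simp only [sum_genericColumnDegree hk δ] at hdet
  refine ⟨ZMod p, inferInstance, inferInstance,
    encoderMatrix (fun j => genericColumnDegree k δ j) g, ?_, ?_, hg.isColDist hk hkn, ?_⟩
  · exact ⟨Fin.castLEEmb hkn.le, (hdet _).1⟩
  · exact ⟨⟨Fin.castLEEmb hkn.le, hdet _⟩, fun d ⟨e, _, he⟩ => he ▸ (hdet e).2.le⟩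
  · rw [revCode_encoderMatrix]
    · exact hgrev.isColDist hk hkn
    · intro w hw
      refine hgrev.eq_zero_of_constantCoeff (Fin.castLEEmb hkn.le) fun i => ?_
      rw [← hw (Fin.castLEEmb hkn.le i)]
      refine Finset.sum_congr rfl fun j _ => ?_
      simp [powerSeriesMatrix, coeff_encoderMatrix]
end

section
/- Let H(z) = Σ_{i=0}^{ν} H_i z^i be the parity-check matrix of an (n,k,δ) convolutional code C over a finite field F, with each H_i an (n−k)×n matrix. Let l ≥ 0 and let E ⊆ {0,…,l}×{1,…,n} be a set of coefficient positions with |E| > (l+ν+1)(n−k). Then there exists a nonzero v(z) ∈ F[z]^n of degree at most l with H(z)v(z) = 0 whose support (the set of coefficient positions at which v is nonzero) is contained in E. In particular, if a codeword of degree at most l is transmitted and more than (l+ν+1)(n−k) erasures occur, unique decoding is not possible. -/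
open Polynomial Matrix

/-- The linear map sending a family of scalars indexed by coefficient positions in `E` to the
polynomial vector having these scalars as coefficients and no others. -/
noncomputable def vectorOfCoeffs {F ι : Type*} [Field F] [DecidableEq ι] (E : Finset (ℕ × ι)) :
    (E → F) →ₗ[F] (ι → F[X]) :=
  LinearMap.pi fun c => ∑ p : E,
    if p.1.2 = c then (Polynomial.monomial p.1.1).comp (LinearMap.proj p) else 0

theorem coeff_vectorOfCoeffs {F ι : Type*} [Field F] [DecidableEq ι] (E : Finset (ℕ × ι))
    (x : E → F) (i : ℕ) (c : ι) :
    (vectorOfCoeffs E x c).coeff i = if h : (i, c) ∈ E then x ⟨(i, c), h⟩ else 0 := by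
  have key : ∀ p : E,
      ((if p.1.2 = c then (Polynomial.monomial p.1.1).comp (LinearMap.proj p) else 0 :
        (E → F) →ₗ[F] F[X]) x).coeff i = if p.1 = (i, c) then x p else 0 := by
    rintro ⟨⟨j, d⟩, hp⟩
    by_cases hd : d = c <;> by_cases hj : j = i <;>
      simp [hd, hj, Polynomial.coeff_monomial]
  simp only [vectorOfCoeffs, LinearMap.pi_apply, LinearMap.sum_apply, Polynomial.finsetSum_coeff,
    key]
  split_ifs with h
  · rw [Finset.sum_eq_single ⟨(i, c), h⟩]
    · simp
    · intro p _ hp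
      exact if_neg fun hpe => hp (Subtype.ext hpe)
    · simp
  · refine Finset.sum_eq_zero fun p _ => if_neg fun hpe => h ?_
    exact hpe ▸ p.2

theorem vectorOfCoeffs_injective {F ι : Type*} [Field F] [DecidableEq ι] (E : Finset (ℕ × ι)) :
    Function.Injective (vectorOfCoeffs (F := F) E) := by
  intro x y hxy
  funext p
  have h := congrArg (fun v => (v p.1.2).coeff p.1.1) hxy
  simpa [coeff_vectorOfCoeffs] using h

theorem natDegree_mulVec_le {F ι κ : Type*} [Field F] [Fintype ι] {H : Matrix κ ι F[X]}
    {v : ι → F[X]} {ν l : ℕ} (hH : ∀ r c, (H r c).natDegree ≤ ν)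
    (hv : ∀ c, (v c).natDegree ≤ l) (r : κ) : (H.mulVec v r).natDegree ≤ l + ν := by
  refine Polynomial.natDegree_sum_le_of_forall_le _ _ fun c _ => ?_
  exact Polynomial.natDegree_mul_le.trans
    ((Nat.add_le_add (hH r c) (hv c)).trans_eq (Nat.add_comm ν l))

/-- The linear map recording the coefficients of `H v` in degrees below `N`. -/
noncomputable def syndromeCoeffs {F ι κ : Type*} [Field F] [Fintype ι] (H : Matrix κ ι F[X])
    (N : ℕ) : (ι → F[X]) →ₗ[F] (Fin N × κ → F) :=
  LinearMap.pi fun q => (Polynomial.lcoeff F q.1).comp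
    ((LinearMap.proj q.2).comp (H.mulVecLin.restrictScalars F))

/-- if `H(z)` (of degree at most `ν`) is the parity-check matrix of an
`(n,k,δ)` convolutional code and `E` is a set of coefficient positions in degrees `≤ l`
with `|E| > (l+ν+1)(n-k)`, then there is a nonzero codeword of degree at most `l` whose
support is contained in `E`; in particular unique decoding is impossible. -/
theorem stmt_5 {F : Type*} [Field F] [Fintype F] {n k : ℕ} (hk : 0 < k) (hkn : k < n)
    (H : Matrix (Fin (n - k)) (Fin n) (Polynomial F))
    (hfull : ∃ e : Fin (n - k) ↪ Fin n, (H.submatrix id (⇑e)).det ≠ 0)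
    (ν : ℕ) (hν : ∀ r c, (H r c).natDegree ≤ ν)
    (l : ℕ) (E : Finset (ℕ × Fin n))
    (hEl : ∀ p ∈ E, p.1 ≤ l)
    (hcard : (l + ν + 1) * (n - k) < E.card) :
    ∃ v : Fin n → Polynomial F, v ≠ 0 ∧ (∀ c, (v c).natDegree ≤ l) ∧
      H.mulVec v = 0 ∧
      ∀ (i : ℕ) (c : Fin n), (v c).coeff i ≠ 0 → (i, c) ∈ E := by
  have hdeg : ∀ (x : E → F) c, (vectorOfCoeffs E x c).natDegree ≤ l := by
    intro x c
    rw [Polynomial.natDegree_le_iff_coeff_eq_zero]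
    intro i hi
    rw [coeff_vectorOfCoeffs, dif_neg]
    exact fun h => absurd (hEl _ h) (by simpa using hi)
  have hker := LinearMap.ker_ne_bot_of_finrank_lt
    (f := (syndromeCoeffs H (l + ν + 1)).comp (vectorOfCoeffs E)) (by simpa using hcard)
  obtain ⟨x, hx, hx0⟩ := Submodule.exists_mem_ne_zero_of_ne_bot hker
  refine ⟨vectorOfCoeffs E x, ?_, hdeg x, ?_, ?_⟩
  · exact (map_ne_zero_iff _ (vectorOfCoeffs_injective E)).mpr hx0
  · ext r i
    by_cases hi : i < l + ν + 1
    · exact congrFun (LinearMap.mem_ker.mp hx) (⟨i, hi⟩, r)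
    · have h := natDegree_mulVec_le hν (hdeg x) r
      simpa using Polynomial.coeff_eq_zero_of_natDegree_lt (by omega)
  · intro i c h
    by_contra hE
    exact h (by rw [coeff_vectorOfCoeffs, dif_neg hE])
end

section
/- Let C be an observable (n,k,δ) convolutional code over a finite field F with parity-check matrix H(z) of degree ν. For every real number r > (n−k)/n there exists l₀ such that for every l ≥ l₀ and every set E ⊆ {0,…,l}×{1,…,n} of erased coefficient positions with |E| ≥ r·(l+1)·n, there is a nonzero codeword of C of degree at most l whose support is contained in E; hence E is not uniquely decodable. In other words, the maximum recovery rate of an (n,k,δ) convolutional code is at most (n−k)/n. -/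
open Polynomial Matrix

/-- The vector of polynomials whose coefficient at position `p ∈ E` is `w p`, and which is zero
outside `E`. -/
noncomputable def polyOfCoeffs {F ι : Type*} [Field F] [DecidableEq ι] (E : Finset (ℕ × ι)) :
    (E → F) →ₗ[F] (ι → F[X]) :=
  LinearMap.pi fun c => ∑ p : E,
    if p.1.2 = c then (monomial p.1.1).comp (LinearMap.proj p) else 0

theorem polyOfCoeffs_coeff {F ι : Type*} [Field F] [DecidableEq ι] (E : Finset (ℕ × ι))
    (w : E → F) (c : ι) (i : ℕ) :
    (polyOfCoeffs E w c).coeff i = ∑ p : E, if p.1 = (i, c) then w p else 0 := by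
  simp only [polyOfCoeffs, LinearMap.pi_apply, LinearMap.sum_apply, finsetSum_coeff]
  refine Finset.sum_congr rfl fun p _ => ?_
  by_cases hc : p.1.2 = c <;> simp [hc, coeff_monomial, Prod.ext_iff]

theorem polyOfCoeffs_coeff_mem {F ι : Type*} [Field F] [DecidableEq ι] (E : Finset (ℕ × ι))
    (w : E → F) (p : E) : (polyOfCoeffs E w p.1.2).coeff p.1.1 = w p := by
  rw [polyOfCoeffs_coeff, Finset.sum_eq_single p]
  · exact if_pos rfl
  · exact fun q _ hq => if_neg fun h => hq (Subtype.ext h)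
  · exact fun h => absurd (Finset.mem_univ p) h

theorem mem_of_polyOfCoeffs_coeff_ne_zero {F ι : Type*} [Field F] [DecidableEq ι]
    (E : Finset (ℕ × ι)) (w : E → F) (c : ι) (i : ℕ)
    (h : (polyOfCoeffs E w c).coeff i ≠ 0) : (i, c) ∈ E := by
  rw [polyOfCoeffs_coeff] at h
  obtain ⟨p, -, hp⟩ := Finset.exists_ne_zero_of_sum_ne_zero h
  have hpc : p.1 = (i, c) := by
    by_contra hne
    exact hp (if_neg hne)
  exact hpc ▸ p.2

/-- If there are more positions than parity-check equations on the coefficients, some nonzero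
codeword is supported on the given positions. -/
theorem exists_codeword_supported {F ι κ : Type*} [Field F] [Fintype ι] [DecidableEq ι] [Fintype κ]
    (H : Matrix κ ι F[X]) (ν l : ℕ) (hν : ∀ r c, (H r c).natDegree ≤ ν)
    (E : Finset (ℕ × ι)) (hE : ∀ p ∈ E, p.1 ≤ l)
    (hcard : Fintype.card κ * (ν + l + 1) < E.card) :
    ∃ v : ι → F[X], v ≠ 0 ∧ (∀ c, (v c).natDegree ≤ l) ∧ H.mulVec v = 0 ∧
      ∀ (i : ℕ) (c : ι), (v c).coeff i ≠ 0 → (i, c) ∈ E := by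
  let S : (E → F) →ₗ[F] (κ × Fin (ν + l + 1) → F) := LinearMap.pi fun q =>
    (lcoeff F q.2).comp ((LinearMap.proj q.1).comp
      ((H.mulVecLin.restrictScalars F).comp (polyOfCoeffs E)))
  have hker : LinearMap.ker S ≠ ⊥ := LinearMap.ker_ne_bot_of_finrank_lt (by simpa using hcard)
  obtain ⟨w, hw, hw0⟩ := Submodule.exists_mem_ne_zero_of_ne_bot hker
  have hdeg : ∀ c, (polyOfCoeffs E w c).natDegree ≤ l := fun c =>
    natDegree_le_iff_coeff_eq_zero.2 fun i hi => by
      by_contra h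
      exact absurd (hE _ (mem_of_polyOfCoeffs_coeff_ne_zero E w c i h)) (not_le.2 hi)
  refine ⟨polyOfCoeffs E w, fun h => hw0 ?_, hdeg, ?_, fun i c =>
    mem_of_polyOfCoeffs_coeff_ne_zero E w c i⟩
  · ext p
    rw [← polyOfCoeffs_coeff_mem E w p, h]
    simp
  · ext r i
    by_cases hi : i < ν + l + 1
    · exact congrFun (LinearMap.mem_ker.1 hw) (r, ⟨i, hi⟩)
    · refine coeff_eq_zero_of_natDegree_lt (lt_of_le_of_lt (b := ν + l) ?_ (by omega))
      exact natDegree_sum_le_of_forall_le _ _ fun c _ =>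
        natDegree_mul_le_of_le (hν r c) (hdeg c)

/-- for every rate `ρ > (n-k)/n` there is `l₀` such that for all `l ≥ l₀`,
every erasure set `E` of coefficient positions in degrees `≤ l` with `|E| ≥ ρ(l+1)n`
supports a nonzero codeword of degree at most `l`; hence `E` is not uniquely decodable.
Thus the maximum recovery rate of an `(n,k,δ)` convolutional code is at most `(n-k)/n`. -/
theorem stmt_6 {F : Type*} [Field F] [Fintype F] {n k : ℕ} (hk : 0 < k) (hkn : k < n)
    (H : Matrix (Fin (n - k)) (Fin n) (Polynomial F))
    (hfull : ∃ e : Fin (n - k) ↪ Fin n, (H.submatrix id (⇑e)).det ≠ 0)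
    (ν : ℕ) (hν : ∀ r c, (H r c).natDegree ≤ ν)
    (ρ : ℝ) (hρ : ((n : ℝ) - k) / n < ρ) :
    ∃ l₀ : ℕ, ∀ l : ℕ, l₀ ≤ l →
      ∀ E : Finset (ℕ × Fin n), (∀ p ∈ E, p.1 ≤ l) →
        ρ * ((l : ℝ) + 1) * (n : ℝ) ≤ (E.card : ℝ) →
        ∃ v : Fin n → Polynomial F, v ≠ 0 ∧ (∀ c, (v c).natDegree ≤ l) ∧
          H.mulVec v = 0 ∧
          ∀ (i : ℕ) (c : Fin n), (v c).coeff i ≠ 0 → (i, c) ∈ E := by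
  have hn : (0 : ℝ) < n := by exact_mod_cast hk.trans hkn
  have hgap : 0 < ρ * n - ((n : ℝ) - k) := by
    rw [div_lt_iff₀ hn] at hρ
    linarith
  obtain ⟨l₀, hl₀⟩ := exists_nat_gt (((n : ℝ) - k) * ν / (ρ * n - ((n : ℝ) - k)))
  rw [div_lt_iff₀ hgap] at hl₀
  refine ⟨l₀, fun l hl E hE hcard => exists_codeword_supported H ν l hν E hE ?_⟩
  have hl' : (l₀ : ℝ) ≤ l := by exact_mod_cast hl
  rw [Fintype.card_fin, ← Nat.cast_lt (α := ℝ)]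
  push_cast [Nat.cast_sub hkn.le]
  nlinarith [mul_le_mul_of_nonneg_right hl' hgap.le]
end

section
/- Let F be a finite field, let α be a nonzero element of F (in the paper, a root of an irreducible polynomial over the prime field), and let a(z) = Π_{i=0}^{l−1}(1 + α^i z) = a_0 + a_1 z + ⋯ + a_l z^l. Let A be the (l+1)×(l+1) lower triangular Toeplitz matrix with first column (a_0, a_1, …, a_l). If A is superregular, then the reversed matrix A_rev, the lower triangular Toeplitz matrix with first column (a_l, a_{l−1}, …, a_0), is also superregular; i.e., A is reverse-superregular. -/
open Polynomial Matrix

/-- The `r × r` lower triangular Toeplitz matrix with first column `a 0, a 1, …, a (r-1)`. -/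
def ltToeplitz {F : Type*} [Zero F] (r : ℕ) (a : ℕ → F) : Matrix (Fin r) (Fin r) F :=
  Matrix.of fun i j => if (j : ℕ) ≤ (i : ℕ) then a ((i : ℕ) - (j : ℕ)) else 0

/-- A lower triangular Toeplitz matrix is superregular if every proper submatrix
(rows `I`, columns `J` with `j_t ≤ i_t` for all `t`) has nonzero determinant. -/
def Superregular {F : Type*} [Field F] {r : ℕ} (A : Matrix (Fin r) (Fin r) F) : Prop :=
  ∀ (s : ℕ) (I J : Fin s → Fin r), StrictMono I → StrictMono J →
    (∀ t, (J t : ℕ) ≤ (I t : ℕ)) → (A.submatrix I J).det ≠ 0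

/-- Reversing `∏ (1 + f i X)` gives `∏ (X + f i)`. -/
lemma reflect_prod_one_add_C_mul_X {R : Type*} [CommRing R] (f : ℕ → R) (l : ℕ) :
    (∏ i ∈ Finset.range l, (1 + C (f i) * X)).reflect l =
      ∏ i ∈ Finset.range l, (X + C (f i)) := by
  induction l with
  | zero => simp
  | succ l ih =>
    have hdeg : (∏ i ∈ Finset.range l, (1 + C (f i) * X)).natDegree ≤ l := by
      refine (natDegree_prod_le _ _).trans ((Finset.sum_le_card_nsmul _ _ 1 ?_).trans (by simp))
      intro i _
      compute_degree
    rw [Finset.prod_range_succ, Finset.prod_range_succ,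
      reflect_mul _ _ hdeg (by compute_degree : (1 + C (f l) * X).natDegree ≤ 1), ih]
    congr 1
    rw [reflect_add, reflect_one, ← pow_one (X : R[X]), reflect_C_mul_X_pow]
    simp [revAt_le]

/-- The reverse of `∏_{i < l} (1 + αⁱ X)` is, up to a nonzero scalar, the same polynomial
with its variable rescaled. -/
lemma exists_coeff_sub_eq {F : Type*} [Field F] (l : ℕ) {α : F} (hα : α ≠ 0) :
    ∃ c β : F, c ≠ 0 ∧ β ≠ 0 ∧ ∀ m ≤ l,
      (∏ i ∈ Finset.range l, (1 + C (α ^ i) * X)).coeff (l - m) =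
        c * β ^ m * (∏ i ∈ Finset.range l, (1 + C (α ^ i) * X)).coeff m := by
  refine ⟨∏ i ∈ Finset.range l, α ^ (l - 1 - i), (α ^ (l - 1))⁻¹,
    Finset.prod_ne_zero_iff.2 fun i _ => pow_ne_zero _ hα, inv_ne_zero (pow_ne_zero _ hα), ?_⟩
  intro m hm
  have hrev : (∏ i ∈ Finset.range l, (1 + C (α ^ i) * X)).reflect l =
      C (∏ i ∈ Finset.range l, α ^ (l - 1 - i)) *
        (∏ i ∈ Finset.range l, (1 + C (α ^ i) * X)).comp (C (α ^ (l - 1))⁻¹ * X) := by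
    rw [reflect_prod_one_add_C_mul_X, ← Finset.prod_range_reflect, prod_comp, map_prod,
      ← Finset.prod_mul_distrib]
    refine Finset.prod_congr rfl fun i hi => ?_
    have hscalar : α ^ (l - 1 - i) * (α ^ i * (α ^ (l - 1))⁻¹) = 1 := by
      rw [← mul_assoc, ← pow_add,
        Nat.sub_add_cancel (Nat.le_sub_one_of_lt (Finset.mem_range.1 hi)),
        mul_inv_cancel₀ (pow_ne_zero _ hα)]
    simp only [add_comp, one_comp, mul_comp, C_comp, X_comp]
    rw [mul_add, mul_one, ← mul_assoc (C (α ^ i)), ← C_mul, ← mul_assoc, ← C_mul, hscalar,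
      C_1, one_mul, add_comm]
  have hcoeff := congrArg (fun p => p.coeff m) hrev
  simp only [coeff_reflect, revAt_le hm, coeff_C_mul, comp_C_mul_X_coeff] at hcoeff
  rw [hcoeff]
  ring

/-- Superregularity of a lower triangular Toeplitz matrix is preserved when the first column
is rescaled by a geometric sequence. -/
lemma Superregular.ltToeplitz_geometric {F : Type*} [Field F] {r : ℕ} {a b : ℕ → F} {c β : F}
    (hc : c ≠ 0) (hβ : β ≠ 0) (hab : ∀ m < r, b m = c * β ^ m * a m)
    (hA : Superregular (ltToeplitz r a)) : Superregular (ltToeplitz r b) := by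
  intro s I J hI hJ hJI
  have hfactor : (ltToeplitz r b).submatrix I J =
      diagonal (fun t => c * β ^ (I t : ℕ)) * (ltToeplitz r a).submatrix I J *
        diagonal (fun t => (β ^ (J t : ℕ))⁻¹) := by
    ext t u
    rw [mul_diagonal, diagonal_mul]
    simp only [submatrix_apply, ltToeplitz, of_apply]
    split_ifs with h
    · rw [hab _ (by omega), pow_sub₀ _ hβ h]
      ring
    · simp
  rw [hfactor, det_mul, det_mul, det_diagonal, det_diagonal]
  exact mul_ne_zero (mul_ne_zero
    (Finset.prod_ne_zero_iff.2 fun t _ => mul_ne_zero hc (pow_ne_zero _ hβ))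
    (hA s I J hI hJ hJI))
    (Finset.prod_ne_zero_iff.2 fun t _ => inv_ne_zero (pow_ne_zero _ hβ))

/-- if `a(z) = ∏_{i=0}^{l-1} (1 + αⁱ z)` and the `(l+1) × (l+1)` lower
triangular Toeplitz matrix `A` with first column the coefficients of `a(z)` is
superregular, then the reversed Toeplitz matrix `A_rev` (first column `a_l, …, a_0`)
is superregular as well; i.e. `A` is reverse-superregular. -/
theorem stmt_8 {F : Type*} [Field F] [Fintype F] (l : ℕ) (α : F) (hα : α ≠ 0)
    (a : ℕ → F)
    (ha : ∀ m, a m = (∏ i ∈ Finset.range l, (1 + C (α ^ i) * X)).coeff m)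
    (hA : Superregular (ltToeplitz (l + 1) a)) :
    Superregular (ltToeplitz (l + 1) (fun m => a (l - m))) := by
  obtain ⟨c, β, hc, hβ, hrev⟩ := exists_coeff_sub_eq l hα
  refine hA.ltToeplitz_geometric hc hβ fun m hm => ?_
  rw [ha, ha, hrev m (Nat.lt_succ_iff.1 hm)]
end

section
/- Let A be an (l+1)×(l+1) lower triangular Toeplitz matrix with first column (a_0, a_1, …, a_l) over the finite field F_{p^e}, and suppose A is reverse-superregular. Then for every α ∈ F_{p^e}^* = F_{p^e}∖{0}, the lower triangular Toeplitz matrix α•A with first column (a_0, α a_1, α² a_2, …, α^l a_l) is reverse-superregular. -/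
open Polynomial Matrix

/-- The `(l+1) × (l+1)` lower triangular Toeplitz matrix with first column
`a 0, …, a l` is reverse-superregular: both it and its reversal
(first column `a l, …, a 0`) are superregular. -/
def RevSuperregular {F : Type*} [Field F] (l : ℕ) (a : ℕ → F) : Prop :=
  Superregular (ltToeplitz (l + 1) a) ∧
    Superregular (ltToeplitz (l + 1) (fun m => a (l - m)))

/-- Geometric rescaling of the first column preserves superregularity. -/
lemma Superregular.ltToeplitz_geom {F : Type*} [Field F] {r : ℕ} {a b : ℕ → F}
    (hA : Superregular (ltToeplitz r a)) {c β : F} (hc : c ≠ 0) (hβ : β ≠ 0)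
    (hb : ∀ m < r, b m = c * β ^ m * a m) : Superregular (ltToeplitz r b) := by
  intro s I J hI hJ hIJ
  have h : (ltToeplitz r b).submatrix I J =
      Matrix.diagonal (fun i => c * β ^ (I i : ℕ)) * (ltToeplitz r a).submatrix I J *
        Matrix.diagonal (fun j => (β ^ (J j : ℕ))⁻¹) := by
    ext i j
    rw [Matrix.mul_diagonal, Matrix.diagonal_mul]
    simp only [ltToeplitz, Matrix.submatrix_apply, Matrix.of_apply]
    split_ifs with hij
    · rw [hb _ (by omega), pow_sub₀ _ hβ hij]
      ring
    · simp
  rw [h, Matrix.det_mul, Matrix.det_mul, Matrix.det_diagonal, Matrix.det_diagonal]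
  refine mul_ne_zero (mul_ne_zero ?_ (hA s I J hI hJ hIJ)) ?_
  · exact Finset.prod_ne_zero_iff.mpr fun i _ => mul_ne_zero hc (pow_ne_zero _ hβ)
  · exact Finset.prod_ne_zero_iff.mpr fun j _ => inv_ne_zero (pow_ne_zero _ hβ)

/-- if the lower triangular Toeplitz matrix with first column
`a_0, a_1, …, a_l` over a finite field is reverse-superregular, then for every nonzero
`α` the matrix `α • A` with first column `a_0, α a_1, α² a_2, …, α^l a_l` is also
reverse-superregular. -/
theorem stmt_9 {F : Type*} [Field F] [Fintype F] (l : ℕ) (a : ℕ → F)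
    (hA : RevSuperregular l a) (α : F) (hα : α ≠ 0) :
    RevSuperregular l (fun m => α ^ m * a m) := by
  refine ⟨hA.1.ltToeplitz_geom one_ne_zero hα fun m _ => by rw [one_mul],
    hA.2.ltToeplitz_geom (pow_ne_zero l hα) (inv_ne_zero hα) fun m hm => ?_⟩
  beta_reduce
  rw [pow_sub₀ α hα (Nat.lt_succ_iff.mp hm), inv_pow]
end

section
/- Let A be an r×r reverse-superregular lower triangular Toeplitz matrix over a finite field with r = (L+1)(2n−k−1), where 0 < k < n and L ≥ 0. For j = 0,1,…,L let I_j = {(j+1)n + j(n−k−1), (j+1)n + j(n−k−1)+1, …, (j+1)(2n−k−1)} and J_j = {jn + j(n−k−1)+1, jn + j(n−k−1)+2, …, (j+1)n + j(n−k−1)}, and set I = ∪_{j=0}^{L} I_j, J = ∪_{j=0}^{L} J_j. Let Ã = A_J^I be the (L+1)(n−k)×(L+1)n submatrix of A formed by the rows indexed by I and the columns indexed by J. Then every (L+1)(n−k)×(L+1)(n−k) full-size minor of Ã formed from columns with indices 1 ≤ i_1 < ⋯ < i_{(L+1)(n−k)} satisfying i_{s(n−k)} ≤ sn for s = 1,2,…,L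 is nonzero. Moreover, the same property holds for Ã_rev, the submatrix of A_rev formed by the same rows I and columns J. -/
open Polynomial Matrix

/-- The 0-based row index in `A` of the `t`-th row of the submatrix `Ã` of Theorem 12:
the `t`-th element of `I = ∪_j I_j`, where (1-based)
`I_j = {(j+1)n + j(n-k-1), …, (j+1)(2n-k-1)}`. -/
def rowIdx12 (n k : ℕ) (t : ℕ) : ℕ :=
  (t / (n - k) + 1) * n + (t / (n - k)) * (n - k - 1) + t % (n - k) - 1

/-- The 0-based column index in `A` of the `u`-th column of `Ã`: the `u`-th element of
`J = ∪_j J_j`, where (1-based) `J_j = {jn + j(n-k-1)+1, …, (j+1)n + j(n-k-1)}`. -/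
def colIdx12 (n k : ℕ) (u : ℕ) : ℕ :=
  (u / n) * n + (u / n) * (n - k - 1) + u % n

lemma rowIdx12_eq {n k : ℕ} (hkn : k < n) (t : ℕ) :
    rowIdx12 n k t = t + (t / (n - k) + 1) * (n - 1) := by
  obtain ⟨m, rfl⟩ : ∃ m, n = k + m + 1 := ⟨n - k - 1, by omega⟩
  have hm : k + m + 1 - k = m + 1 := by omega
  have h := Nat.div_add_mod t (m + 1)
  unfold rowIdx12
  rw [hm, Nat.add_sub_cancel, Nat.add_sub_cancel]
  generalize t / (m + 1) = q at *
  generalize t % (m + 1) = ρ at *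
  subst h
  rw [Nat.sub_eq_iff_eq_add (by nlinarith)]
  ring

lemma colIdx12_eq (n k u : ℕ) : colIdx12 n k u = u + u / n * (n - k - 1) := by
  have h := Nat.div_add_mod' u n
  unfold colIdx12
  omega

lemma rowIdx12_strictMono {n k : ℕ} (hkn : k < n) : StrictMono (rowIdx12 n k) := by
  intro s t hst
  rw [rowIdx12_eq hkn, rowIdx12_eq hkn]
  have : s / (n - k) ≤ t / (n - k) := Nat.div_le_div_right hst.le
  exact add_lt_add_of_lt_of_le hst (by gcongr)

lemma colIdx12_strictMono (n k : ℕ) : StrictMono (colIdx12 n k) := by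
  intro s t hst
  rw [colIdx12_eq, colIdx12_eq]
  have : s / n ≤ t / n := Nat.div_le_div_right hst.le
  exact add_lt_add_of_lt_of_le hst (by gcongr)

lemma rowIdx12_lt {n k L t : ℕ} (hkn : k < n) (ht : t < (L + 1) * (n - k)) :
    rowIdx12 n k t < (L + 1) * (2 * n - k - 1) := by
  have hq : t / (n - k) + 1 ≤ L + 1 := Nat.div_lt_of_lt_mul (by rwa [mul_comm])
  have hr : 2 * n - k - 1 = (n - k) + (n - 1) := by omega
  rw [rowIdx12_eq hkn, hr, mul_add]
  exact add_lt_add_of_lt_of_le ht (Nat.mul_le_mul_right _ hq)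

lemma colIdx12_le_rowIdx12 {n k t u : ℕ} (hkn : k < n) (hu : u < (t / (n - k) + 1) * n) :
    colIdx12 n k u ≤ rowIdx12 n k t := by
  have hp : u / n ≤ t / (n - k) :=
    Nat.lt_succ_iff.mp (Nat.div_lt_of_lt_mul (by rwa [mul_comm]))
  have ht := Nat.div_mul_le_self t (n - k)
  rw [rowIdx12_eq hkn, colIdx12_eq]
  obtain ⟨m, rfl⟩ : ∃ m, n = k + m + 1 := ⟨n - k - 1, by omega⟩
  have hm : k + m + 1 - k = m + 1 := by omega
  rw [hm] at hp hu ht ⊢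
  simp only [Nat.add_sub_cancel]
  generalize t / (m + 1) = q at *
  have := Nat.mul_le_mul_right m hp
  nlinarith

/-- The selected minors of the submatrix cut out by `rowIdx12` and `colIdx12` are proper minors
of the Toeplitz matrix. -/
lemma Superregular.det_submatrix_ne_zero {F : Type*} [Field F] {n k L : ℕ} (hkn : k < n)
    {b : ℕ → F} (hsr : Superregular (ltToeplitz ((L + 1) * (2 * n - k - 1)) b))
    {M : Matrix (Fin ((L + 1) * (n - k))) (Fin ((L + 1) * n)) F}
    (hM : ∀ t u, M t u =
      if colIdx12 n k (u : ℕ) ≤ rowIdx12 n k (t : ℕ) then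
        b (rowIdx12 n k (t : ℕ) - colIdx12 n k (u : ℕ))
      else 0)
    {φ : Fin ((L + 1) * (n - k)) → Fin ((L + 1) * n)} (hφ : StrictMono φ)
    (hbound : ∀ s : ℕ, 1 ≤ s → s ≤ L → ∀ h : s * (n - k) - 1 < (L + 1) * (n - k),
      (φ ⟨s * (n - k) - 1, h⟩ : ℕ) < s * n) :
    (M.submatrix id φ).det ≠ 0 := by
  have hle : ∀ t, colIdx12 n k (φ t) ≤ rowIdx12 n k t := by
    intro t
    apply colIdx12_le_rowIdx12 hkn
    have hq : (t : ℕ) / (n - k) < L + 1 :=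
      Nat.div_lt_of_lt_mul (t.isLt.trans_eq (mul_comm _ _))
    rcases Nat.lt_succ_iff_lt_or_eq.mp hq with hq | hq
    · have ht : (t : ℕ) < ((t : ℕ) / (n - k) + 1) * (n - k) :=
        Nat.lt_mul_of_div_lt (Nat.lt_succ_self _) (by omega)
      have hmul : ((t : ℕ) / (n - k) + 1) * (n - k) ≤ (L + 1) * (n - k) :=
        Nat.mul_le_mul_right _ (by omega)
      have hlt : ((t : ℕ) / (n - k) + 1) * (n - k) - 1 < (L + 1) * (n - k) := by omega
      have hmono : φ t ≤ φ ⟨_, hlt⟩ := hφ.monotone (Fin.le_def.mpr (by simp only; omega))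
      exact lt_of_le_of_lt (Fin.le_def.mp hmono) (hbound _ (Nat.le_add_left 1 _) hq hlt)
    · rw [hq]
      exact (φ t).isLt
  have hrow (t : Fin ((L + 1) * (n - k))) : rowIdx12 n k t < (L + 1) * (2 * n - k - 1) :=
    rowIdx12_lt hkn t.isLt
  have hdet := hsr _ (fun t => ⟨rowIdx12 n k t, hrow t⟩)
    (fun t => ⟨colIdx12 n k (φ t), (hle t).trans_lt (hrow t)⟩)
    (fun _ _ h => rowIdx12_strictMono hkn h) (fun _ _ h => colIdx12_strictMono n k (hφ h)) hle
  convert hdet using 2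
  ext t u
  simp [hM, ltToeplitz]

/-- extracting the rows `I` and columns `J` from an
`(L+1)(2n-k-1) × (L+1)(2n-k-1)` reverse-superregular lower triangular Toeplitz matrix
yields an `(L+1)(n-k) × (L+1)n` matrix `Ã` all of whose full-size minors with column
indices satisfying `i_{s(n-k)} ≤ sn` (`s = 1, …, L`) are nonzero; and the same holds for
the corresponding submatrix `Ã_rev` of the reversed Toeplitz matrix. -/
theorem stmt_12 {F : Type*} [Field F] [Fintype F] {n k L : ℕ} (hk : 0 < k) (hkn : k < n)
    (a : ℕ → F)
    (hsr : Superregular (ltToeplitz ((L + 1) * (2 * n - k - 1)) a))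
    (hsrrev : Superregular (ltToeplitz ((L + 1) * (2 * n - k - 1))
      (fun m => a ((L + 1) * (2 * n - k - 1) - 1 - m))))
    (Atil Atilrev : Matrix (Fin ((L + 1) * (n - k))) (Fin ((L + 1) * n)) F)
    (hAtil : ∀ t u, Atil t u =
      if colIdx12 n k (u : ℕ) ≤ rowIdx12 n k (t : ℕ) then
        a (rowIdx12 n k (t : ℕ) - colIdx12 n k (u : ℕ))
      else 0)
    (hAtilrev : ∀ t u, Atilrev t u =
      if colIdx12 n k (u : ℕ) ≤ rowIdx12 n k (t : ℕ) then
        a ((L + 1) * (2 * n - k - 1) - 1 - (rowIdx12 n k (t : ℕ) - colIdx12 n k (u : ℕ)))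
      else 0) :
    (∀ φ : Fin ((L + 1) * (n - k)) → Fin ((L + 1) * n), StrictMono φ →
      (∀ s : ℕ, 1 ≤ s → s ≤ L → ∀ h : s * (n - k) - 1 < (L + 1) * (n - k),
        (φ ⟨s * (n - k) - 1, h⟩ : ℕ) < s * n) →
      (Atil.submatrix id φ).det ≠ 0) ∧
    (∀ φ : Fin ((L + 1) * (n - k)) → Fin ((L + 1) * n), StrictMono φ →
      (∀ s : ℕ, 1 ≤ s → s ≤ L → ∀ h : s * (n - k) - 1 < (L + 1) * (n - k),
        (φ ⟨s * (n - k) - 1, h⟩ : ℕ) < s * n) →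
      (Atilrev.submatrix id φ).det ≠ 0) := by
  exact ⟨fun _ hφ hb => hsr.det_submatrix_ne_zero hkn hAtil hφ hb,
    fun _ hφ hb => hsrrev.det_submatrix_ne_zero hkn hAtilrev hφ hb⟩
end

section
/- Let C be an (n,k,δ) convolutional code over a finite field F with (n−k) dividing δ, with parity-check matrix H(z) = H_0 + H_1 z + ⋯ + H_ν z^ν where H_ν has full rank, δ = ν(n−k), and L = ⌊δ/k⌋ + ν. If C is a complete-MDP convolutional code (every full-size minor of the partial parity-check matrix that is not trivially zero is nonzero), then C is reverse-MDP; in particular, C is MDP. Concretely: every (L+1)(n−k)×(L+1)(n−k) full-size minor of the lower block triangular matrix ℋ_L (block rows (H_0), (H_1, H_0), …, (H_L,…,H_0)) formed from columns r_1<⋯<r_{(L+1)(n−k)} with r_{s(n−k)} ≤ sn for s=1,…,L is nonzero, and every full-size minor of the upper block triangular matrix with block rows (H_ν, H_{ν−1},…,H_{ν−L}), (0, H_ν,…,H_{ν−L+1}), …, (0,…,0,H_ν) formed from columns j_1<⋯<j_{(L+1)(n−k)} with j_{s(n−k)+1} > sn for s=1,…,L is nonzero. -/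
open Polynomial Matrix

/-- A strictly monotone map between initial segments of `ℕ` grows by at least one per step. -/
lemma Fin.val_add_le_of_strictMono {N M : ℕ} {φ : Fin N → Fin M} (hφ : StrictMono φ) (a d : ℕ)
    (h : a + d < N) : (φ ⟨a, by omega⟩ : ℕ) + d ≤ φ ⟨a + d, h⟩ := by
  induction d with
  | zero => simp
  | succ d ih =>
    have h₁ := ih (by omega)
    have h₂ : φ ⟨a + d, by omega⟩ < φ ⟨a + (d + 1), h⟩ := hφ (Fin.mk_lt_mk.2 (by omega))
    have h₃ := Fin.lt_def.1 h₂
    omega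

lemma Fin.le_val_of_strictMono {N M : ℕ} {φ : Fin N → Fin M} (hφ : StrictMono φ) (a : ℕ)
    (h : a < N) : a ≤ φ ⟨a, h⟩ := by
  have h₁ := Fin.val_add_le_of_strictMono hφ 0 a (by omega)
  simp only [Nat.zero_add] at h₁
  omega

lemma Fin.val_add_sub_le_of_strictMono {N M : ℕ} {φ : Fin N → Fin M} (hφ : StrictMono φ) (a : ℕ)
    (h : a < N) : φ ⟨a, h⟩ + (N - a) ≤ M := by
  have h₁ := Fin.val_add_le_of_strictMono hφ a (N - 1 - a) (by omega)
  have h₂ := (φ ⟨a + (N - 1 - a), by omega⟩).isLt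
  omega

/-- a complete-MDP convolutional code (all not-trivially-zero full-size
minors of the partial parity-check matrix are nonzero) is reverse-MDP, in particular MDP:
the corresponding full-size minors of the lower block triangular matrix `ℋ_L` and of the
upper block triangular matrix built from `H_ν, …, H_{ν-L}` are all nonzero. -/
theorem stmt_14 {F : Type*} [Field F] [Fintype F] {n k δ ν L : ℕ}
    (hk : 0 < k) (hkn : k < n)
    (hdvd : (n - k) ∣ δ) (hν : ν = δ / (n - k)) (hL : L = δ / k + ν)
    (Hc : ℕ → Matrix (Fin (n - k)) (Fin n) F)
    (hHzero : ∀ i : ℕ, ν < i → Hc i = 0)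
    (hHν : ∃ e : Fin (n - k) ↪ Fin n, ((Hc ν).submatrix id (⇑e)).det ≠ 0)
    -- the partial parity-check matrix
    (P : Matrix (Fin ((L + 1) * (n - k))) (Fin ((ν + L + 1) * n)) F)
    (hP : ∀ r c, P r c =
      if (r : ℕ) / (n - k) ≤ (c : ℕ) / n ∧ (c : ℕ) / n ≤ (r : ℕ) / (n - k) + ν then
        Hc (ν - ((c : ℕ) / n - (r : ℕ) / (n - k)))
          ⟨(r : ℕ) % (n - k), Nat.mod_lt _ (by omega)⟩
          ⟨(c : ℕ) % n, Nat.mod_lt _ (by omega)⟩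
      else 0)
    -- complete-MDP property: all not-trivially-zero full-size minors of `P` are nonzero
    (hcomplete : ∀ φ : Fin ((L + 1) * (n - k)) → Fin ((ν + L + 1) * n), StrictMono φ →
      (∀ s : ℕ, 1 ≤ s → s ≤ L →
        ∀ (h1 : s * (n - k) < (L + 1) * (n - k)) (h2 : s * (n - k) - 1 < (L + 1) * (n - k)),
          s * n ≤ (φ ⟨s * (n - k), h1⟩ : ℕ) ∧
          (φ ⟨s * (n - k) - 1, h2⟩ : ℕ) < s * n + ν * n) →
      (P.submatrix id φ).det ≠ 0)
    -- the lower block triangular matrix ℋ_L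
    (HL : Matrix (Fin ((L + 1) * (n - k))) (Fin ((L + 1) * n)) F)
    (hHL : ∀ r c, HL r c =
      if (c : ℕ) / n ≤ (r : ℕ) / (n - k) then
        Hc ((r : ℕ) / (n - k) - (c : ℕ) / n)
          ⟨(r : ℕ) % (n - k), Nat.mod_lt _ (by omega)⟩
          ⟨(c : ℕ) % n, Nat.mod_lt _ (by omega)⟩
      else 0)
    -- the upper block triangular matrix with block rows (H_ν, …, H_{ν-L}), … , (0,…,0,H_ν)
    (U : Matrix (Fin ((L + 1) * (n - k))) (Fin ((L + 1) * n)) F)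
    (hU : ∀ r c, U r c =
      if (r : ℕ) / (n - k) ≤ (c : ℕ) / n ∧ (c : ℕ) / n ≤ (r : ℕ) / (n - k) + ν then
        Hc (ν - ((c : ℕ) / n - (r : ℕ) / (n - k)))
          ⟨(r : ℕ) % (n - k), Nat.mod_lt _ (by omega)⟩
          ⟨(c : ℕ) % n, Nat.mod_lt _ (by omega)⟩
      else 0) :
    (∀ φ : Fin ((L + 1) * (n - k)) → Fin ((L + 1) * n), StrictMono φ →
      (∀ s : ℕ, 1 ≤ s → s ≤ L → ∀ h : s * (n - k) - 1 < (L + 1) * (n - k),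
        (φ ⟨s * (n - k) - 1, h⟩ : ℕ) < s * n) →
      (HL.submatrix id φ).det ≠ 0) ∧
    (∀ φ : Fin ((L + 1) * (n - k)) → Fin ((L + 1) * n), StrictMono φ →
      (∀ s : ℕ, 1 ≤ s → s ≤ L → ∀ h : s * (n - k) < (L + 1) * (n - k),
        s * n ≤ (φ ⟨s * (n - k), h⟩ : ℕ)) →
      (U.submatrix id φ).det ≠ 0) := by
  have hn : 0 < n := by omega
  have hLk : L * k ≤ ν * n := by
    have h₁ : δ / k * k ≤ δ := Nat.div_mul_le_self δ k
    have h₂ : ν * (n - k) = δ := by rw [hν, Nat.div_mul_cancel hdvd]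
    have h₃ : ν * n = ν * (n - k) + ν * k := by rw [← Nat.mul_add, Nat.sub_add_cancel hkn.le]
    rw [hL, Nat.add_mul]
    omega
  obtain ⟨m, rfl⟩ : ∃ m, n = m + k := ⟨n - k, by omega⟩
  have hm : m + k - k = m := by omega
  have hsize : (ν + L + 1) * (m + k) = (L + 1) * (m + k) + ν * (m + k) := by ring
  constructor
  · intro φ hφ hlt
    let ψ : Fin ((L + 1) * (m + k - k)) → Fin ((ν + L + 1) * (m + k)) :=
      fun i => ⟨φ i + ν * (m + k), by have := (φ i).isLt; omega⟩
    have hψ : StrictMono ψ := fun i j hij => by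
      have := Fin.lt_def.1 (hφ hij)
      exact Fin.mk_lt_mk.2 (by omega)
    have hsub : HL.submatrix id φ = P.submatrix id ψ := by
      ext r i
      have hdiv : ((φ i : ℕ) + ν * (m + k)) / (m + k) = (φ i : ℕ) / (m + k) + ν :=
        Nat.add_mul_div_right _ _ hn
      simp only [submatrix_apply, id_eq, hHL, hP, ψ, hdiv, Nat.add_mul_mod_self_right]
      generalize (φ i : ℕ) / (m + k) = c
      generalize (r : ℕ) / (m + k - k) = b
      by_cases h₁ : c ≤ b
      · by_cases h₂ : b ≤ c + ν
        · rw [if_pos h₁, if_pos ⟨h₂, by omega⟩, show ν - (c + ν - b) = b - c by omega]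
        · rw [if_pos h₁, if_neg (by omega), hHzero _ (by omega), Matrix.zero_apply]
      · rw [if_neg h₁, if_neg (by omega)]
    rw [hsub]
    refine hcomplete ψ hψ fun s hs hsL h₁ h₂ => ⟨?_, ?_⟩
    · have h₃ := Fin.le_val_of_strictMono hφ _ h₁
      have h₄ : s * k ≤ L * k := Nat.mul_le_mul_right k hsL
      have h₅ : s * (m + k) = s * m + s * k := Nat.mul_add ..
      have h₆ : s * (m + k - k) = s * m := by rw [hm]
      change s * (m + k) ≤ (φ ⟨s * (m + k - k), h₁⟩ : ℕ) + ν * (m + k)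
      omega
    · exact Nat.add_lt_add_right (hlt s hs hsL h₂) _
  · intro φ hφ hle
    let ψ : Fin ((L + 1) * (m + k - k)) → Fin ((ν + L + 1) * (m + k)) :=
      fun i => (φ i).castLE (by omega)
    have hψ : StrictMono ψ := fun i j hij => hφ hij
    have hsub : U.submatrix id φ = P.submatrix id ψ := by
      ext r i
      simp only [submatrix_apply, id_eq, hU, hP, ψ, Fin.val_castLE]
    rw [hsub]
    refine hcomplete ψ hψ fun s hs hsL h₁ h₂ => ⟨hle s hs hsL h₁, ?_⟩
    have h₃ := Fin.val_add_sub_le_of_strictMono hφ _ h₂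
    obtain ⟨t, rfl⟩ : ∃ t, L = s + t := ⟨L - s, by omega⟩
    have h₄ : (t + 1) * k ≤ (s + t) * k := Nat.mul_le_mul_right k (by omega)
    have h₅ : (s + t + 1) * (m + k) = s * (m + k) + (t + 1) * m + (t + 1) * k := by ring
    have h₆ : (s + t + 1) * (m + k - k) = s * (m + k - k) + (t + 1) * m := by rw [hm]; ring
    have h₇ : 0 < s * (m + k - k) := Nat.mul_pos hs (by omega)
    change (φ ⟨s * (m + k - k) - 1, h₂⟩ : ℕ) < s * (m + k) + ν * (m + k)
    omega
end

section
/- Let C be a complete-MDP (n,k,δ) convolutional code over a finite field F with (n−k) | δ, parity-check matrix H(z) = H_0 + ⋯ + H_ν z^ν with H_ν of full rank, ν = δ/(n−k), and L = ⌊δ/k⌋ + ν. Consider a window of (ν+L+1)n consecutive symbols of a transmitted codeword and a set E of erased positions in this window with |E| ≤ (L+1)(n−k), such that for every s = 1,2,…,L+1 the first sn positions of the window contain at most s(n−k) elements of E and the last sn positions of the window contain at most s(n−k) elements of E. Then all erased symbols in the window can be uniquely recovered: the columns of the partial parity-check matrix indexed by E are linearly independent, so the linear system determined by the parity-check equations and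 the correctly received symbols has a unique solution. In particular, a new guard space can be computed. -/
open Polynomial Matrix

/-- The number of elements of `Fin M` in the interval `[a, b)`. -/
theorem card_filter_fin_Ico {M a b : ℕ} (hb : b ≤ M) :
    (Finset.univ.filter (fun p : Fin M => a ≤ (p : ℕ) ∧ (p : ℕ) < b)).card = b - a := by
  rw [← Nat.card_Ico, ← Finset.card_map Fin.valEmbedding]
  congr 1
  ext x
  simp only [Finset.mem_map, Finset.mem_filter, Finset.mem_univ, true_and,
    Fin.valEmbedding_apply, Finset.mem_Ico]
  constructor
  · rintro ⟨p, hp, rfl⟩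
    exact hp
  · intro hx
    exact ⟨⟨x, by omega⟩, hx, rfl⟩

/-- `E` has at most `(L+1)m` elements, and for `1 ≤ s ≤ L+1` at most `sm` of them lie among the
first, and at most `sm` among the last, `sn` positions. -/
def IsAdmissible_s15 (m n L T : ℕ) (E : Finset (Fin (T * n))) : Prop :=
  E.card ≤ (L + 1) * m ∧
  (∀ s : ℕ, 1 ≤ s → s ≤ L + 1 →
    (E.filter (fun p : Fin (T * n) => (p : ℕ) < s * n)).card ≤ s * m) ∧
  ∀ s : ℕ, 1 ≤ s → s ≤ L + 1 →
    (E.filter (fun p : Fin (T * n) => T * n - s * n ≤ (p : ℕ))).card ≤ s * m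

/-- A bound on the number of elements satisfying `q` persists after inserting an element that
satisfies `q` only if the bound is not attained. -/
theorem card_filter_insert_le {α : Type*} [DecidableEq α] {E : Finset α} {x : α} (q : α → Prop)
    [DecidablePred q] {b : ℕ} (h : (E.filter q).card ≤ b) (hx : q x → (E.filter q).card ≠ b) :
    ((insert x E).filter q).card ≤ b := by
  rw [Finset.filter_insert]
  split_ifs with hq
  · have := Finset.card_insert_le x (E.filter q)
    have := hx hq
    omega
  · exact h

/-- An admissible set with fewer than `(L+1)m` elements can be enlarged. -/
theorem IsAdmissible_s15.exists_insert {m n k ν L T : ℕ} (hn : n = m + k) (hT : T = ν + L + 1)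
    (hL : (L - ν) * k ≤ ν * m) {E : Finset (Fin (T * n))}
    (hE : IsAdmissible_s15 m n L T E) (hlt : E.card < (L + 1) * m) :
    ∃ x ∉ E, IsAdmissible_s15 m n L T (insert x E) := by
  classical
  obtain ⟨hcard, hfirst, hlast⟩ := hE
  let pre : ℕ → ℕ := fun s => (E.filter (fun p : Fin (T * n) => (p : ℕ) < s * n)).card
  let suf : ℕ → ℕ := fun s => (E.filter (fun p : Fin (T * n) => T * n - s * n ≤ (p : ℕ))).card
  obtain ⟨s, hs, hsL, hsmax⟩ : ∃ s, pre s = s * m ∧ s ≤ L ∧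
      ∀ i, i ≤ L + 1 → pre i = i * m → i ≤ s := by
    have h0 : pre 0 = 0 * m := by simp [pre]
    have hg := Nat.findGreatest_spec (P := fun s => pre s = s * m) (Nat.zero_le (L + 1)) h0
    refine ⟨_, hg, ?_, fun i hi h => Nat.le_findGreatest hi h⟩
    have hle := Nat.findGreatest_le (P := fun s => pre s = s * m) (L + 1)
    by_contra hc
    have heq : Nat.findGreatest (fun s => pre s = s * m) (L + 1) = L + 1 := by omega
    rw [heq] at hg
    have : pre (L + 1) ≤ E.card := Finset.card_filter_le _ _
    omega
  obtain ⟨t, ht, htL, htmax⟩ : ∃ t, suf t = t * m ∧ t ≤ L ∧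
      ∀ i, i ≤ L + 1 → suf i = i * m → i ≤ t := by
    have h0 : suf 0 = 0 * m := by
      simp only [suf, zero_mul, Finset.card_eq_zero, Finset.filter_eq_empty_iff]
      intro p _
      have := p.isLt
      omega
    have hg := Nat.findGreatest_spec (P := fun s => suf s = s * m) (Nat.zero_le (L + 1)) h0
    refine ⟨_, hg, ?_, fun i hi h => Nat.le_findGreatest hi h⟩
    have hle := Nat.findGreatest_le (P := fun s => suf s = s * m) (L + 1)
    by_contra hc
    have heq : Nat.findGreatest (fun s => suf s = s * m) (L + 1) = L + 1 := by omega
    rw [heq] at hg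
    have : suf (L + 1) ≤ E.card := Finset.card_filter_le _ _
    omega
  have hst : s + t ≤ T := by
    by_contra hc
    obtain ⟨x, hx⟩ := Nat.exists_eq_add_of_le (show T ≤ s + t by omega)
    have hinter : ((E.filter (fun p : Fin (T * n) => (p : ℕ) < s * n)) ∩
        (E.filter (fun p : Fin (T * n) => T * n - t * n ≤ (p : ℕ)))).card ≤ x * n := by
      have hsub : (T * n - t * n) + x * n = s * n := by
        have h1 : t * n ≤ T * n := Nat.mul_le_mul_right _ (by omega)
        have h2 : s * n + t * n = T * n + x * n := by rw [← add_mul, hx, add_mul]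
        omega
      calc _ ≤ (Finset.univ.filter
            (fun p : Fin (T * n) => T * n - t * n ≤ (p : ℕ) ∧ (p : ℕ) < s * n)).card := by
            apply Finset.card_le_card
            intro p hp
            simp only [Finset.mem_inter, Finset.mem_filter, Finset.mem_univ, true_and] at hp ⊢
            exact ⟨hp.2.2, hp.1.2⟩
        _ = s * n - (T * n - t * n) :=
            card_filter_fin_Ico (Nat.mul_le_mul_right _ (by omega))
        _ ≤ x * n := by omega
    have hunion := Finset.card_union_add_card_inter
      (E.filter (fun p : Fin (T * n) => (p : ℕ) < s * n))
      (E.filter (fun p : Fin (T * n) => T * n - t * n ≤ (p : ℕ)))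
    have hle : ((E.filter (fun p : Fin (T * n) => (p : ℕ) < s * n)) ∪
        (E.filter (fun p : Fin (T * n) => T * n - t * n ≤ (p : ℕ)))).card ≤ E.card :=
      Finset.card_le_card
        (Finset.union_subset (Finset.filter_subset _ _) (Finset.filter_subset _ _))
    have hxk : x * k ≤ (L - ν) * k := Nat.mul_le_mul_right _ (by omega)
    have hsum : s * m + t * m = ν * m + (L + 1) * m + x * m := by
      rw [← add_mul, hx, hT]; ring
    have hxn : x * n = x * m + x * k := by rw [hn, mul_add]
    simp only [pre, suf] at hs ht
    omega
  obtain ⟨x, hxE, hxs, hxt⟩ : ∃ x : Fin (T * n), x ∉ E ∧ s * n ≤ (x : ℕ) ∧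
      (x : ℕ) < T * n - t * n := by
    by_contra! hc
    obtain ⟨d, hd⟩ := Nat.exists_eq_add_of_le hst
    have hTn : T * n = s * n + t * n + d * n := by rw [hd, add_mul, add_mul]
    have hmid : d * n ≤ (E.filter (fun p : Fin (T * n) =>
        s * n ≤ (p : ℕ) ∧ (p : ℕ) < T * n - t * n)).card := by
      calc d * n = (T * n - t * n) - s * n := by omega
        _ = _ := (card_filter_fin_Ico (Nat.sub_le _ _)).symm
        _ ≤ _ := by
          apply Finset.card_le_card
          intro p hp
          simp only [Finset.mem_filter, Finset.mem_univ, true_and] at hp ⊢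
          refine ⟨?_, hp⟩
          by_contra hpE
          have := hc p hpE hp.1
          omega
    have h1 := Finset.card_filter_add_card_filter_not (s := E)
      (fun p : Fin (T * n) => (p : ℕ) < s * n)
    have h2 := Finset.card_filter_add_card_filter_not
      (s := E.filter (fun p : Fin (T * n) => ¬ (p : ℕ) < s * n))
      (fun p : Fin (T * n) => (p : ℕ) < T * n - t * n)
    rw [Finset.filter_filter, Finset.filter_filter] at h2
    have h3 : E.filter (fun p : Fin (T * n) => ¬ (p : ℕ) < s * n ∧ (p : ℕ) < T * n - t * n) =
        E.filter (fun p : Fin (T * n) => s * n ≤ (p : ℕ) ∧ (p : ℕ) < T * n - t * n) :=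
      Finset.filter_congr fun p _ => by rw [not_lt]
    have h4 : E.filter (fun p : Fin (T * n) => ¬ (p : ℕ) < s * n ∧ ¬ (p : ℕ) < T * n - t * n) =
        E.filter (fun p : Fin (T * n) => T * n - t * n ≤ (p : ℕ)) :=
      Finset.filter_congr fun p _ => by omega
    rw [h3, h4] at h2
    simp only [pre, suf] at hs ht
    have h5 : (L + 1) * m ≤ T * m := Nat.mul_le_mul_right _ (by omega)
    have h6 : T * m = s * m + t * m + d * m := by rw [hd, add_mul, add_mul]
    have h7 : d * m ≤ d * n := Nat.mul_le_mul_left _ (by omega)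
    omega
  refine ⟨x, hxE, ?_, fun i hi hiL => ?_, fun i hi hiL => ?_⟩
  · rw [Finset.card_insert_of_notMem hxE]
    exact hlt
  · refine card_filter_insert_le _ (hfirst i hi hiL) fun hxi heq => ?_
    have := Nat.mul_le_mul_right n (hsmax i hiL heq)
    omega
  · refine card_filter_insert_le _ (hlast i hi hiL) fun hxi heq => ?_
    have := Nat.mul_le_mul_right n (htmax i hiL heq)
    omega

/-- Every admissible set is contained in an admissible set with exactly `(L+1)m` elements. -/
theorem IsAdmissible_s15.exists_superset {m n k ν L T : ℕ} (hn : n = m + k) (hT : T = ν + L + 1)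
    (hL : (L - ν) * k ≤ ν * m) {E : Finset (Fin (T * n))}
    (hE : IsAdmissible_s15 m n L T E) :
    ∃ E', E ⊆ E' ∧ IsAdmissible_s15 m n L T E' ∧ E'.card = (L + 1) * m := by
  induction hd : (L + 1) * m - E.card generalizing E with
  | zero => exact ⟨E, subset_rfl, hE, by have := hE.1; omega⟩
  | succ d ih =>
    obtain ⟨x, hx, hxE⟩ := hE.exists_insert hn hT hL (by omega)
    obtain ⟨E', hsub, hE'⟩ := ih hxE (by rw [Finset.card_insert_of_notMem hx]; omega)
    exact ⟨E', (Finset.subset_insert x E).trans hsub, hE'⟩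

/-- If at most `i` elements of `S` are smaller than `a`, then the element of `S` of index `i` is
at least `a`. -/
theorem le_orderEmbOfFin_of_card_filter_le {M N : ℕ} {S : Finset (Fin M)} (hS : S.card = N)
    {a : ℕ} (i : Fin N) (h : (S.filter (fun p : Fin M => (p : ℕ) < a)).card ≤ i) :
    a ≤ (S.orderEmbOfFin hS i : ℕ) := by
  by_contra! hc
  have hsub : (Finset.Iic i).map (S.orderEmbOfFin hS).toEmbedding ⊆
      S.filter (fun p : Fin M => (p : ℕ) < a) := by
    intro p hp
    obtain ⟨j, hj, rfl⟩ := Finset.mem_map.1 hp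
    refine Finset.mem_filter.2 ⟨S.orderEmbOfFin_mem hS j, lt_of_le_of_lt ?_ hc⟩
    exact (S.orderEmbOfFin hS).monotone (Finset.mem_Iic.1 hj)
  have := Finset.card_le_card hsub
  rw [Finset.card_map, Fin.card_Iic] at this
  omega

/-- If fewer than `N - i` of the `N` elements of `S` are at least `a`, then the element of `S` of
index `i` is smaller than `a`. -/
theorem orderEmbOfFin_lt_of_card_filter_lt {M N : ℕ} {S : Finset (Fin M)} (hS : S.card = N)
    {a : ℕ} (i : Fin N) (h : (S.filter (fun p : Fin M => a ≤ (p : ℕ))).card < N - i) :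
    (S.orderEmbOfFin hS i : ℕ) < a := by
  by_contra! hc
  have hsub : (Finset.Ici i).map (S.orderEmbOfFin hS).toEmbedding ⊆
      S.filter (fun p : Fin M => a ≤ (p : ℕ)) := by
    intro p hp
    obtain ⟨j, hj, rfl⟩ := Finset.mem_map.1 hp
    refine Finset.mem_filter.2 ⟨S.orderEmbOfFin_mem hS j, le_trans hc ?_⟩
    exact (S.orderEmbOfFin hS).monotone (Finset.mem_Ici.1 hj)
  have := Finset.card_le_card hsub
  rw [Finset.card_map, Fin.card_Ici] at this
  omega

/-- If the columns of `P` indexed by `E` are linearly independent, a vector in the kernel of `P`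
is determined by its entries outside `E`. -/
theorem eq_of_mulVec_eq_zero_of_linearIndependent {F ι κ : Type*} [Field F] [Fintype κ]
    {P : Matrix ι κ F} {E : Finset κ}
    (hE : LinearIndependent F (fun p : E => fun r : ι => P r (p : κ))) {v w : κ → F}
    (hv : P.mulVec v = 0) (hw : P.mulVec w = 0) (hvw : ∀ p, p ∉ E → v p = w p) : v = w := by
  classical
  rw [Fintype.linearIndependent_iff] at hE
  have hzero := hE (fun p => v p - w p) (by
    ext r
    have hr : ∑ p, P r p * (v p - w p) = 0 := by
      have := congrFun (show P.mulVec (v - w) = 0 by rw [Matrix.mulVec_sub, hv, hw, sub_zero]) r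
      simpa [Matrix.mulVec, dotProduct] using this
    rw [← Finset.sum_subset (Finset.subset_univ E)
      (fun p _ hp => by rw [hvw p hp, sub_self, mul_zero]), ← Finset.sum_coe_sort] at hr
    simpa [mul_comm] using hr)
  ext p
  by_cases hp : p ∈ E
  · exact sub_eq_zero.1 (hzero ⟨p, hp⟩)
  · exact hvw p hp

/-- for a complete-MDP convolutional code, in any window of `(ν+L+1)n`
symbols, any erasure set `E` with at most `(L+1)(n-k)` erasures such that the first `sn`
positions contain at most `s(n-k)` erasures and the last `sn` positions contain at most
`s(n-k)` erasures (for `s = 1, …, L+1`), can be uniquely recovered: the columns of the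
partial parity-check matrix indexed by `E` are linearly independent, and the associated
linear system has a unique solution. -/
theorem stmt_15 {F : Type*} [Field F] [Fintype F] {n k δ ν L : ℕ}
    (hk : 0 < k) (hkn : k < n)
    (hdvd : (n - k) ∣ δ) (hν : ν = δ / (n - k)) (hL : L = δ / k + ν)
    (Hc : ℕ → Matrix (Fin (n - k)) (Fin n) F)
    (hHzero : ∀ i : ℕ, ν < i → Hc i = 0)
    (hHν : ∃ e : Fin (n - k) ↪ Fin n, ((Hc ν).submatrix id (⇑e)).det ≠ 0)
    -- the partial parity-check matrix
    (P : Matrix (Fin ((L + 1) * (n - k))) (Fin ((ν + L + 1) * n)) F)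
    (hP : ∀ r c, P r c =
      if (r : ℕ) / (n - k) ≤ (c : ℕ) / n ∧ (c : ℕ) / n ≤ (r : ℕ) / (n - k) + ν then
        Hc (ν - ((c : ℕ) / n - (r : ℕ) / (n - k)))
          ⟨(r : ℕ) % (n - k), Nat.mod_lt _ (by omega)⟩
          ⟨(c : ℕ) % n, Nat.mod_lt _ (by omega)⟩
      else 0)
    -- complete-MDP property: all not-trivially-zero full-size minors of `P` are nonzero
    (hcomplete : ∀ φ : Fin ((L + 1) * (n - k)) → Fin ((ν + L + 1) * n), StrictMono φ →
      (∀ s : ℕ, 1 ≤ s → s ≤ L →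
        ∀ (h1 : s * (n - k) < (L + 1) * (n - k)) (h2 : s * (n - k) - 1 < (L + 1) * (n - k)),
          s * n ≤ (φ ⟨s * (n - k), h1⟩ : ℕ) ∧
          (φ ⟨s * (n - k) - 1, h2⟩ : ℕ) < s * n + ν * n) →
      (P.submatrix id φ).det ≠ 0)
    -- the erased positions in the window
    (E : Finset (Fin ((ν + L + 1) * n)))
    (hcard : E.card ≤ (L + 1) * (n - k))
    (hfirst : ∀ s : ℕ, 1 ≤ s → s ≤ L + 1 →
      (E.filter (fun p : Fin ((ν + L + 1) * n) => (p : ℕ) < s * n)).card ≤ s * (n - k))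
    (hlast : ∀ s : ℕ, 1 ≤ s → s ≤ L + 1 →
      (E.filter (fun p : Fin ((ν + L + 1) * n) => (ν + L + 1) * n - s * n ≤ (p : ℕ))).card ≤ s * (n - k)) :
    LinearIndependent F (fun p : E => fun r : Fin ((L + 1) * (n - k)) => P r (p : Fin ((ν + L + 1) * n))) ∧
    ∀ v w : Fin ((ν + L + 1) * n) → F,
      P.mulVec v = 0 → P.mulVec w = 0 → (∀ p, p ∉ E → v p = w p) → v = w := by
  have hm : 0 < n - k := by omega
  have hδ : (L - ν) * k ≤ ν * (n - k) := by
    rw [hν, Nat.div_mul_cancel hdvd, ← hν, hL, Nat.add_sub_cancel]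
    exact Nat.div_mul_le_self δ k
  obtain ⟨E', hsub, ⟨-, hfirst', hlast'⟩, hcard'⟩ :=
    IsAdmissible_s15.exists_superset (show n = n - k + k by omega) rfl hδ ⟨hcard, hfirst, hlast⟩
  set φ := E'.orderEmbOfFin hcard'
  have hdet : (P.submatrix id φ).det ≠ 0 := by
    refine hcomplete φ φ.strictMono fun s hs hsL h1 h2 => ⟨?_, ?_⟩
    · exact le_orderEmbOfFin_of_card_filter_le hcard' _ (hfirst' s hs (by omega))
    · refine orderEmbOfFin_lt_of_card_filter_lt hcard' _ ?_
      obtain ⟨u, rfl⟩ := Nat.exists_eq_add_of_le hsL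
      have hwin : (ν + (s + u) + 1) * n - (u + 1) * n = s * n + ν * n := by
        rw [← Nat.sub_mul, ← add_mul]
        congr 1
        omega
      have hcount := hlast' (u + 1) (by omega) (by omega)
      rw [hwin] at hcount
      have hsplit : (s + u + 1) * (n - k) = s * (n - k) + (u + 1) * (n - k) := by ring
      have hpos : 0 < s * (n - k) := Nat.mul_pos hs hm
      simp only
      omega
  have hcols : LinearIndependent F (fun i => fun r => P r (φ i)) :=
    Matrix.linearIndependent_cols_of_det_ne_zero hdet
  have hsurj : ∀ p : E, ∃ i, φ i = (p : Fin ((ν + L + 1) * n)) := fun p => by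
    have hp : (p : Fin ((ν + L + 1) * n)) ∈ Set.range φ := by
      rw [Finset.range_orderEmbOfFin]
      exact hsub p.2
    exact hp
  choose g hg using hsurj
  have hginj : Function.Injective g := fun p q hpq => Subtype.ext (by rw [← hg p, ← hg q, hpq])
  have hlin : LinearIndependent F
      (fun p : E => fun r : Fin ((L + 1) * (n - k)) => P r (p : Fin ((ν + L + 1) * n))) := by
    have := hcols.comp g hginj
    simpa only [Function.comp_def, hg] using this
  exact ⟨hlin, fun v w hv hw => eq_of_mulVec_eq_zero_of_linearIndependent hlin hv hw⟩
end

section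
/- Let C be an (n,k,δ) convolutional code over a finite field F. Then its free distance satisfies the generalized Singleton bound: d_free(C) ≤ (n−k)(⌊δ/k⌋ + 1) + δ + 1. -/
open Polynomial Matrix

/-- The weight of a vector of polynomials: the total number of nonzero coefficients. -/
noncomputable def polyWeight {F : Type*} [Semiring F] {n : ℕ} (v : Fin n → Polynomial F) : ℕ :=
  ∑ c : Fin n, (v c).support.card

section Quotient

variable {F ι : Type*} [Field F] [Fintype ι] [DecidableEq ι]

theorem Matrix.mulVecLin_injective_of_det_ne_zero {R : Type*} [CommRing R] [IsDomain R]
    {M : Matrix ι ι R} (hM : M.det ≠ 0) : Function.Injective M.mulVecLin := by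
  rw [injective_iff_map_eq_zero]
  exact fun v hv => Matrix.eq_zero_of_mulVec_eq_zero hM hv

/-- The cokernel of a nonsingular square polynomial matrix has dimension the degree of the
determinant. -/
theorem Matrix.finite_and_finrank_quotient_range_mulVecLin {M : Matrix ι ι F[X]}
    (hM : M.det ≠ 0) :
    Module.Finite F ((ι → F[X]) ⧸ LinearMap.range M.mulVecLin) ∧
      Module.finrank F ((ι → F[X]) ⧸ LinearMap.range M.mulVecLin) = M.det.natDegree := by
  have hinj := Matrix.mulVecLin_injective_of_det_ne_zero hM
  have hrank : Module.finrank F[X] (LinearMap.range M.mulVecLin) =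
      Module.finrank F[X] (ι → F[X]) := LinearMap.finrank_range_of_inj hinj
  let b := Pi.basisFun F[X] ι
  let a := Submodule.smithNormalFormCoeffs b hrank
  let b' := Submodule.smithNormalFormTopBasis b hrank
  let ab := Submodule.smithNormalFormBotBasis b hrank
  have ha : ∀ i, a i ≠ 0 := Submodule.smithNormalFormCoeffs_ne_zero b hrank
  have hfin : ∀ i, Module.Finite F (F[X] ⧸ Ideal.span ({a i} : Set F[X])) := fun i =>
    PowerBasis.finite (AdjoinRoot.powerBasis (ha i))
  refine ⟨Module.Finite.equiv (Submodule.quotientEquivDirectSum F b hrank).symm, ?_⟩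
  have hassoc : Associated M.det (∏ i, a i) := by
    rw [← Matrix.det_diagonal, ← LinearMap.det_toLin b' (diagonal a), ← LinearMap.det_toLin' M]
    let e := (b'.equiv ab (Equiv.refl _)).trans (LinearEquiv.ofInjective _ hinj).symm
    refine (LinearMap.associated_det_of_eq_comp e _ _ ?_).symm
    intro x
    suffices h : Matrix.toLin b' b' (diagonal a) = M.mulVecLin ∘ₗ e.toLinearMap from
      LinearMap.congr_fun h x
    refine b'.ext fun i => ?_
    have h₁ : M.mulVecLin (e (b' i)) = ab i := by
      simp [e]
    rw [LinearMap.comp_apply, LinearEquiv.coe_coe, h₁, Matrix.toLin_self]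
    simp only [diagonal_apply, ite_smul, zero_smul, Finset.sum_ite_eq', Finset.mem_univ, if_true]
    exact (Submodule.smithNormalFormBotBasis_def b hrank i).symm
  rw [natDegree_eq_of_degree_eq (degree_eq_degree_of_associated hassoc),
    natDegree_prod _ _ fun i _ => ha i, Submodule.finrank_quotient_eq_sum F b hrank]
  exact Finset.sum_congr rfl fun i _ => (AdjoinRoot.powerBasis (ha i)).finrank

/-- Any set of more than `deg det M` coefficient positions supports a nonzero vector in the
column module of `M`. -/
theorem Matrix.exists_mulVec_ne_zero_of_natDegree_det_lt_card {M : Matrix ι ι F[X]}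
    (hM : M.det ≠ 0) (S : Finset (ι × ℕ)) (hS : M.det.natDegree < S.card) :
    ∃ u : ι → F[X], M *ᵥ u ≠ 0 ∧ ∀ i j, ((M *ᵥ u) i).coeff j ≠ 0 → (i, j) ∈ S := by
  obtain ⟨hfin, hrank⟩ := Matrix.finite_and_finrank_quotient_range_mulVecLin hM
  let φ : (S → F) →ₗ[F] (ι → F[X]) :=
    ∑ p : S, (LinearMap.single F (fun _ : ι => F[X]) p.1.1 ∘ₗ monomial p.1.2) ∘ₗ LinearMap.proj p
  have hcoeff (x : S → F) (i : ι) (j : ℕ) :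
      (φ x i).coeff j = ∑ p : S, if p.1 = (i, j) then x p else 0 := by
    simp only [φ, LinearMap.sum_apply, LinearMap.comp_apply, Finset.sum_apply, finsetSum_coeff]
    refine Finset.sum_congr rfl fun p _ => ?_
    obtain ⟨⟨i', j'⟩, hp⟩ := p
    by_cases hi : i' = i
    · subst hi
      simp [coeff_monomial]
    · simp [hi, Ne.symm hi]
  let q := (LinearMap.range M.mulVecLin).mkQ.restrictScalars F
  obtain ⟨x, hx, hx0⟩ : ∃ x ∈ LinearMap.ker (q ∘ₗ φ), x ≠ 0 := by
    refine Submodule.exists_mem_ne_zero_of_ne_bot (LinearMap.ker_ne_bot_of_finrank_lt ?_)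
    rw [hrank]
    simpa using hS
  have hx' : φ x ∈ LinearMap.range M.mulVecLin := by simpa [q] using hx
  obtain ⟨u, hu⟩ := hx'
  rw [Matrix.mulVecLin_apply] at hu
  refine ⟨u, ?_, fun i j hij => ?_⟩
  · obtain ⟨p, hp⟩ := Function.ne_iff.mp hx0
    intro h0
    have := hcoeff x p.1.1 p.1.2
    rw [← hu, h0, Finset.sum_eq_single p (fun r _ hr => if_neg fun h => hr (Subtype.ext h))
      (by simp)] at this
    exact hp (by simpa using this.symm)
  · by_contra hS'
    rw [hu, hcoeff] at hij
    exact hij (Finset.sum_eq_zero fun p _ => if_neg fun (h : p.1 = (i, j)) => hS' (h ▸ p.2))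

end Quotient

/-- Cramer's rule in dual form: a linear functional `c` evaluated at `u` is expressed through
the values `M *ᵥ u`. -/
theorem Matrix.det_mul_dotProduct_eq_sum_det_updateRow {R ι : Type*} [CommRing R] [Fintype ι]
    [DecidableEq ι] (M : Matrix ι ι R) (c u : ι → R) :
    M.det * (c ⬝ᵥ u) = ∑ i, (M.updateRow i c).det * (M *ᵥ u) i := by
  have h := congrArg (· ⬝ᵥ u) (Matrix.mulVec_cramer Mᵀ c)
  simp only [det_transpose, smul_dotProduct, smul_eq_mul, mulVec_transpose] at h
  rw [← h, ← dotProduct_mulVec]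
  simp only [dotProduct, cramer_transpose_apply]

/-- If the rows `e` of `G` give a minor of maximal degree, then bounding the degrees of the
entries of a codeword at `e` bounds the degrees of all its entries. -/
theorem natDegree_mulVec_le_of_isCodeDegree {F : Type*} [Field F] {n k δ m : ℕ}
    {G : Matrix (Fin n) (Fin k) F[X]} (hδ : IsCodeDegree G δ) {e : Fin k ↪ Fin n}
    (he : (G.submatrix e id).det ≠ 0) (hdeg : (G.submatrix e id).det.natDegree = δ)
    {u : Fin k → F[X]} (hu : ∀ i, ((G *ᵥ u) (e i)).natDegree ≤ m) (c : Fin n) :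
    ((G *ᵥ u) c).natDegree ≤ m := by
  by_cases hc : c ∈ Set.range e
  · obtain ⟨i, rfl⟩ := hc
    exact hu i
  have hminor (i : Fin k) : ((G.submatrix e id).updateRow i (G c)).det.natDegree ≤ δ := by
    have hinj : Function.Injective (Function.update e i c) := by
      intro a b hab
      by_cases ha : a = i <;> by_cases hb : b = i
      · rw [ha, hb]
      · subst ha
        simp only [Function.update_self, Function.update_of_ne hb] at hab
        exact absurd ⟨b, hab.symm⟩ hc
      · subst hb
        simp only [Function.update_self, Function.update_of_ne ha] at hab
        exact absurd ⟨a, hab⟩ hc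
      · simpa [ha, hb] using hab
    have hsub : (G.submatrix e id).updateRow i (G c) =
        G.submatrix (⟨_, hinj⟩ : Fin k ↪ Fin n) id := by
      ext a b
      by_cases ha : a = i
      · subst ha; simp
      · simp [ha]
    by_cases h0 : ((G.submatrix e id).updateRow i (G c)).det = 0
    · simp [h0]
    · exact hδ.2 ⟨⟨_, hinj⟩, hsub ▸ h0, by rw [hsub]⟩
  by_cases h0 : (G *ᵥ u) c = 0
  · simp [h0]
  have hcramer := Matrix.det_mul_dotProduct_eq_sum_det_updateRow (G.submatrix e id) (G c) u
  have hle : ((G.submatrix e id).det * (G *ᵥ u) c).natDegree ≤ δ + m := by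
    change ((G.submatrix e id).det * (G c ⬝ᵥ u)).natDegree ≤ δ + m
    rw [hcramer]
    exact natDegree_sum_le_of_forall_le _ _ fun i _ => natDegree_mul_le_of_le (hminor i) (hu i)
  rw [natDegree_mul he h0, hdeg] at hle
  omega

theorem polyWeight_eq_sum_range_add {F : Type*} [Semiring F] {n k : ℕ} (e : Fin k ↪ Fin n)
    (v : Fin n → F[X]) :
    polyWeight v = ∑ i, (v (e i)).support.card +
      ∑ c ∈ (Finset.univ.map e)ᶜ, (v c).support.card := by
  rw [polyWeight, ← Finset.sum_add_sum_compl (Finset.univ.map e), Finset.sum_map]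

/-- the generalized Singleton bound — the free distance of an `(n,k,δ)`
convolutional code satisfies `d_free ≤ (n-k)(⌊δ/k⌋ + 1) + δ + 1`. -/
theorem stmt_16 {F : Type*} [Field F] [Fintype F] {n k δ : ℕ} (hk : 0 < k) (hkn : k < n)
    (G : Matrix (Fin n) (Fin k) (Polynomial F))
    (hfull : ∃ e : Fin k ↪ Fin n, (G.submatrix (⇑e) id).det ≠ 0)
    (hδ : IsCodeDegree G δ)
    (C : Set (Fin n → Polynomial F))
    (hC : C = {v | ∃ u : Fin k → Polynomial F, v = G.mulVec u})
    (d : ℕ)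
    (hd : IsLeast {w | ∃ v ∈ C, v ≠ 0 ∧ polyWeight v = w} d) :
    d ≤ (n - k) * (δ / k + 1) + δ + 1 := by
  obtain ⟨⟨e, he, hdeg⟩, -⟩ := id hδ
  set m := δ / k
  have hcard : δ + 1 ≤ (Finset.univ ×ˢ Finset.range (m + 1) : Finset (Fin k × ℕ)).card := by
    simpa [mul_comm] using Nat.lt_mul_div_succ δ hk
  obtain ⟨S, hSsub, hScard⟩ := Finset.exists_subset_card_eq hcard
  obtain ⟨u, hu0, huS⟩ :=
    Matrix.exists_mulVec_ne_zero_of_natDegree_det_lt_card he S (by omega)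
  replace huS : ∀ i j, ((G *ᵥ u) (e i)).coeff j ≠ 0 → (i, j) ∈ S := huS
  have hdegle : ∀ c, ((G *ᵥ u) c).natDegree ≤ m := by
    refine natDegree_mulVec_le_of_isCodeDegree hδ he hdeg fun i => ?_
    refine natDegree_le_iff_coeff_eq_zero.mpr fun j hj => ?_
    by_contra h
    have := hSsub (huS i j h)
    simp only [Finset.mem_product, Finset.mem_univ, Finset.mem_range, true_and] at this
    omega
  have hne : G *ᵥ u ≠ 0 := fun h => hu0 <| funext fun i => congrFun h (e i)
  refine (hd.2 ⟨G *ᵥ u, hC ▸ ⟨u, rfl⟩, hne, rfl⟩).trans ?_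
  have hinside : ∑ i, ((G *ᵥ u) (e i)).support.card ≤ δ + 1 := by
    rw [← hScard, ← Finset.card_sigma]
    refine Finset.card_le_card_of_injOn (fun p => (p.1, p.2)) ?_ ?_
    · rintro ⟨i, j⟩ hp
      exact huS i j (by simpa using hp)
    · rintro ⟨i, j⟩ - ⟨i', j'⟩ - h
      simpa using h
  have houtside : ∑ c ∈ (Finset.univ.map e)ᶜ, ((G *ᵥ u) c).support.card ≤
      (n - k) * (m + 1) := by
    refine (Finset.sum_le_card_nsmul _ _ (m + 1) fun c _ => ?_).trans_eq ?_
    · exact (card_supp_le_succ_natDegree _).trans (Nat.succ_le_succ (hdegle c))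
    · simp [Finset.card_compl]
  rw [polyWeight_eq_sum_range_add e]
  omega
end
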